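/- arXiv:1502.02851 — 4 statements merged into one kernel-verified Lean document; each statement's English description precedes it below -/
import Mathlib

section
/- Proposition 1 (region-dependent small gain attractivity). Let V be a storage function on ℝ^n and W a storage function on ℝ^m, let f ∈ C¹(ℝ^n × ℝ^m, ℝ^n), g ∈ C¹(ℝ^n × ℝ^m, ℝ^m), and suppose Assumption 1 (with class K∞ gains γ, δ, continuous positive definite proper λ_x, λ_z, and constants 0 ≤ M̲ < M̄ < ∞, 0 ≤ N̲ < N̄ < ∞) and Assumption 2 hold, and that M̃ := max{γ⁻¹(M̲), N̲} < min{δ(M̄), N̄} =: M̂. Then there exists a continuous, proper, positive definite function U : ℝ^n × ℝ^m → [0,∞) that is locally Lipschitz on (ℝ^n × ℝ^m) \ {(0,0)} such that for every y₀ ∈ Ω_{≤M̂}(U) \ Ω_{≤M̃}(U) and every forward-complete solution Y of the interconnected system with Y(0) = y₀, one has limsup_{t→∞} U(Y(t)) ≤ M̃. -/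
open Filter Topology Set

noncomputable section

/-- A function of class `K∞`: continuous, strictly increasing and vanishing at `0`
on `[0,∞)`, and tending to `∞`. -/
def ClassKInf (α : ℝ → ℝ) : Prop :=
  ContinuousOn α (Set.Ici 0) ∧ StrictMonoOn α (Set.Ici 0) ∧ α 0 = 0 ∧
    Filter.Tendsto α Filter.atTop Filter.atTop

/-- Positive definite function. -/
def PosDefFun {E : Type*} [NormedAddCommGroup E] (U : E → ℝ) : Prop :=
  U 0 = 0 ∧ ∀ y : E, y ≠ 0 → 0 < U y

/-- Proper function: `U y → ∞` as `‖y‖ → ∞`. -/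
def ProperFun {E : Type*} [NormedAddCommGroup E] (U : E → ℝ) : Prop :=
  ∀ C : ℝ, ∃ R : ℝ, ∀ y : E, R ≤ ‖y‖ → C ≤ U y

/-- Storage function: locally Lipschitz, nonnegative and sandwiched between two
class `K∞` functions of the norm. -/
def IsStorage {E : Type*} [NormedAddCommGroup E] (V : E → ℝ) : Prop :=
  (∀ x, 0 ≤ V x) ∧ LocallyLipschitz V ∧
    ∃ a b : ℝ → ℝ, ClassKInf a ∧ ClassKInf b ∧ ∀ x : E, a ‖x‖ ≤ V x ∧ V x ≤ b ‖x‖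

/-- Locally Lipschitz on a set. -/
def LocallyLipschitzOnSet {E F : Type*} [PseudoMetricSpace E] [PseudoMetricSpace F]
    (f : E → F) (s : Set E) : Prop :=
  ∀ y ∈ s, ∃ K : NNReal, ∃ t ∈ 𝓝[s] y, LipschitzOnWith K f t

/-- Dini derivative of `U` in the direction `v` at the point `y`, with values in
the extended reals. -/
noncomputable def dini {E : Type*} [NormedAddCommGroup E] [NormedSpace ℝ E]
    (U : E → ℝ) (v : E) (y : E) : EReal :=
  Filter.limsup (fun τ : ℝ => (((U (y + τ • v) - U y) / τ : ℝ) : EReal)) (𝓝[>] (0:ℝ))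

/-- Divergence of a vector field: trace of the Jacobian. -/
noncomputable def diverg {E : Type*} [NormedAddCommGroup E] [NormedSpace ℝ E]
    (F : E → E) (y : E) : ℝ :=
  LinearMap.trace ℝ E (fderiv ℝ F y : E →ₗ[ℝ] E)

theorem aux_h (G : ℝ → ℝ → ℝ) (hG : Continuous (fun p : ℝ × ℝ => G p.1 p.2)) (Ml Mu : ℝ)
    (hMl : 0 ≤ Ml) (hMlu : Ml < Mu)
    (hA2 : ∀ s : ℝ, Ml ≤ s → s ≤ Mu → s ≠ 0 → G s 0 < s) :
    ∃ h : ℝ → ℝ, Continuous h ∧ Monotone h ∧ (∀ s, 0 ≤ h s) ∧ (∀ s, 0 < s → 0 < h s) ∧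
      ∀ s e, Ml ≤ s → s ≤ Mu → 0 ≤ e → e < h s → G s e < s := by
  let B : Set (ℝ × ℝ) := (Icc Ml Mu ×ˢ Icc 0 1) ∩ {p | p.1 ≤ G p.1 p.2 ∨ p.2 = 1}
  have hBc : IsCompact B := by
    refine (isCompact_Icc.prod isCompact_Icc).inter_right ?_
    exact (isClosed_le continuous_fst hG).union (isClosed_eq continuous_snd continuous_const)
  have hone : ∀ s, Ml ≤ s → s ≤ Mu → (s, (1:ℝ)) ∈ B := fun s h1 h2 => by
    simp [B, h1, h2]
  have hBn : B.Nonempty := ⟨_, hone Ml le_rfl hMlu.le⟩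
  let φ : ℝ → ℝ × ℝ → ℝ := fun s p => p.2 + max (s - p.1) 0
  have hφ : Continuous (fun q : ℝ × (ℝ × ℝ) => φ q.1 q.2) := by fun_prop
  let h : ℝ → ℝ := fun s => sInf (φ s '' B)
  have hatt : ∀ s, ∃ p ∈ B, h s = φ s p := fun s =>
    hBc.exists_sInf_image_eq hBn (by fun_prop)
  have hle : ∀ s, ∀ p ∈ B, h s ≤ φ s p := fun s p hp =>
    csInf_le (hBc.image (by fun_prop)).bddBelow (mem_image_of_mem _ hp)
  have hpos : ∀ s, 0 < s → 0 < h s := by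
    intro s hs
    obtain ⟨⟨t, e⟩, ⟨⟨ht, he⟩, hp⟩, heq⟩ := hatt s
    rw [heq]
    simp only [φ, mem_ofPred_eq] at *
    rcases he.1.lt_or_eq with h0 | h0
    · have := le_max_right (s - t) 0
      linarith
    · have ht0 : t = 0 := by
        by_contra hne
        have := hA2 t ht.1 ht.2 hne
        subst h0
        rcases hp with hp | hp
        · linarith
        · norm_num at hp
      have := le_max_left (s - t) 0
      linarith
  refine ⟨h, ?_, ?_, ?_, hpos, ?_⟩
  · exact hBc.continuous_sInf hφ
  · intro s s' hss
    obtain ⟨p, hp, heq⟩ := hatt s'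
    rw [heq]
    refine (hle s p hp).trans ?_
    simp only [φ]
    gcongr
  · intro s
    obtain ⟨⟨t, e⟩, ⟨⟨ht, he⟩, hp⟩, heq⟩ := hatt s
    rw [heq]
    have := le_max_right (s - t) 0
    have := he.1
    simp only [φ] at *
    linarith
  · intro s e h1 h2 h3 h4
    by_contra hcon
    have hs1 := hle s _ (hone s h1 h2)
    simp only [φ, sub_self, max_self, add_zero] at hs1
    have : (s, e) ∈ B := ⟨⟨⟨h1, h2⟩, ⟨h3, by simp only; linarith⟩⟩, Or.inl (not_lt.1 hcon)⟩
    have := hle s _ this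
    simp [φ] at this
    linarith

theorem aux_sigma (γ δ : ℝ → ℝ) (hγ : ClassKInf γ) (hδ : ClassKInf δ) (Ml Mu : ℝ)
    (hMl : 0 ≤ Ml) (hMlu : Ml < Mu)
    (hA2 : ∀ s : ℝ, Ml ≤ s → s ≤ Mu → s ≠ 0 → γ (δ s) < s) :
    ∃ σ : ℝ → ℝ, Continuous σ ∧ σ 0 = 0 ∧ (∀ s, 0 < s → ContDiffAt ℝ 1 σ s) ∧
      MonotoneOn σ (Ici 0) ∧ (∀ s, 0 ≤ s → δ s ≤ σ s) ∧
      (∀ s, Ml ≤ s → s ≤ Mu → γ (σ s) ≤ s) ∧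
      (∀ a, 0 < a → ∃ c, 0 < c ∧ ∀ s t, a ≤ s → s ≤ t → c * (t - s) ≤ σ t - σ s) := by
  obtain ⟨hδc, hδm, hδ0, hδt⟩ := hδ
  obtain ⟨hγc, hγm, hγ0, hγt⟩ := hγ
  let d : ℝ → ℝ := fun x => δ (max x 0)
  have hdc : Continuous d := hδc.comp_continuous (by fun_prop) (fun x => le_max_right x 0)
  have hdm : Monotone d := fun x y hxy =>
    hδm.monotoneOn (le_max_right x 0) (le_max_right y 0) (max_le_max_right 0 hxy)
  have hd : ∀ s, 0 ≤ s → d s = δ s := fun s hs => by simp [d, hs]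
  have hd0 : d 0 = 0 := by rw [hd 0 le_rfl, hδ0]
  let k : ℝ → ℝ := fun x => γ (max x 0)
  have hkc : Continuous k := hγc.comp_continuous (by fun_prop) (fun x => le_max_right x 0)
  have hk : ∀ s, 0 ≤ s → k s = γ s := fun s hs => by simp [k, hs]
  have hkm : Monotone k := fun x y hxy =>
    hγm.monotoneOn (le_max_right x 0) (le_max_right y 0) (max_le_max_right 0 hxy)
  have hdnn : ∀ s, 0 ≤ s → 0 ≤ d s := fun s hs => hd0 ▸ hdm hs
  obtain ⟨h, hhc, hhm, hhnn, hhpos, hhG⟩ := aux_h (fun s e => k (d (s + e) + e)) (by fun_prop)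
    Ml Mu hMl hMlu (by
      intro s h1 h2 h3
      have hs : 0 ≤ s := hMl.trans h1
      simp only [add_zero]
      rw [hk _ (hdnn s hs), hd s hs]
      exact hA2 s h1 h2 h3)
  have hC : 0 < Mu + 1 := by linarith
  let η : ℝ → ℝ := fun s => (∫ x in (0:ℝ)..s, h x) / (Mu + 1)
  have hηd : ∀ s, HasDerivAt η (h s / (Mu + 1)) s := fun s =>
    (intervalIntegral.integral_hasDerivAt_right (hhc.intervalIntegrable _ _)
      (hhc.stronglyMeasurableAtFilter _ _) hhc.continuousAt).div_const _
  have hηC : ContDiff ℝ 1 η := by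
    rw [contDiff_one_iff_deriv]
    refine ⟨fun s => (hηd s).differentiableAt, ?_⟩
    have : deriv η = fun s => h s / (Mu + 1) := funext fun s => (hηd s).deriv
    rw [this]; fun_prop
  have hηc : Continuous η := hηC.continuous
  have hη0 : η 0 = 0 := by simp [η]
  have hηslope : ∀ a s t, a ≤ s → s ≤ t → h a / (Mu + 1) * (t - s) ≤ η t - η s := by
    intro a s t has hst
    have e : η t - η s = (∫ x in s..t, h x) / (Mu + 1) := by
      simp only [η]
      rw [← sub_div, intervalIntegral.integral_interval_sub_left] <;>
        exact hhc.intervalIntegrable _ _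
    rw [e, div_mul_eq_mul_div]
    gcongr
    have := intervalIntegral.integral_mono_on (μ := MeasureTheory.volume) (f := fun _ => h a)
      (g := h) hst (by simp) (hhc.intervalIntegrable _ _) (fun x hx => hhm (has.trans hx.1))
    simp at this
    linarith
  have hηm : Monotone η := by
    intro s t hst
    have := hηslope s s t le_rfl hst
    have h2 : 0 ≤ h s / (Mu + 1) * (t - s) :=
      mul_nonneg (div_nonneg (hhnn s) hC.le) (by linarith)
    linarith
  have hηpos : ∀ s, 0 < s → 0 < η s := by
    intro s hs
    have h1 := hηslope (s/2) (s/2) s le_rfl (by linarith)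
    have h2 : 0 < h (s/2) / (Mu + 1) * (s - s/2) :=
      mul_pos (div_pos (hhpos _ (by linarith)) hC) (by linarith)
    have h3 := hηm (show 0 ≤ s/2 by linarith)
    linarith
  have hηnn : ∀ s, 0 ≤ s → 0 ≤ η s := fun s hs => hη0 ▸ hηm hs
  have hηlt : ∀ s, 0 < s → s ≤ Mu → η s < h s := by
    intro s hs hsM
    simp only [η]
    rw [div_lt_iff₀ hC]
    have := intervalIntegral.integral_mono_on (μ := MeasureTheory.volume) (f := h)
      (g := fun _ => h s) hs.le (hhc.intervalIntegrable _ _) (by simp) (fun x hx => hhm hx.2)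
    simp at this
    have := hhpos s hs
    nlinarith
  let A : ℝ → ℝ := fun s => ∫ u in (0:ℝ)..1, d (s + η s * u)
  have hAc : Continuous A := by
    apply intervalIntegral.continuous_parametric_intervalIntegral_of_continuous'
    simp only [Function.uncurry_def]
    fun_prop
  have hAm : ∀ s t, s ≤ t → A s ≤ A t := by
    intro s t hst
    apply intervalIntegral.integral_mono_on (by norm_num)
      (Continuous.intervalIntegrable (by fun_prop) _ _)
      (Continuous.intervalIntegrable (by fun_prop) _ _)
    intro u hu
    apply hdm
    have := mul_le_mul_of_nonneg_right (hηm hst) hu.1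
    linarith
  have hAl : ∀ s, 0 ≤ s → d s ≤ A s := by
    intro s hs
    have := intervalIntegral.integral_mono_on (μ := MeasureTheory.volume) (a := 0) (b := 1)
      (f := fun _ => d s) (g := fun u => d (s + η s * u)) (by norm_num) (by simp)
      (Continuous.intervalIntegrable (by fun_prop) _ _) (fun u hu => hdm (by
        have := mul_nonneg (hηnn s hs) hu.1
        linarith))
    simpa using this
  have hAu : ∀ s, 0 ≤ s → A s ≤ d (s + η s) := by
    intro s hs
    have := intervalIntegral.integral_mono_on (μ := MeasureTheory.volume) (a := 0) (b := 1)
      (g := fun _ => d (s + η s)) (f := fun u => d (s + η s * u)) (by norm_num)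
      (Continuous.intervalIntegrable (by fun_prop) _ _) (by simp) (fun u hu => hdm (by
        have := mul_le_of_le_one_right (hηnn s hs) hu.2
        linarith))
    simpa using this
  have hA0 : A 0 = 0 := by simp [A, hη0, hd0]
  let P : ℝ → ℝ := fun s => ∫ x in (0:ℝ)..s, d x
  have hPd : ∀ s, HasDerivAt P (d s) s := fun s =>
    (intervalIntegral.integral_hasDerivAt_right (hdc.intervalIntegrable _ _)
      (hdc.stronglyMeasurableAtFilter _ _) hdc.continuousAt)
  have hPC : ContDiff ℝ 1 P := by
    rw [contDiff_one_iff_deriv]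
    refine ⟨fun s => (hPd s).differentiableAt, ?_⟩
    have : deriv P = d := funext fun s => (hPd s).deriv
    rw [this]; exact hdc
  have hAP : ∀ s, 0 < s → A s = (η s)⁻¹ * (P (s + η s) - P s) := by
    intro s hs
    simp only [A, P]
    rw [intervalIntegral.integral_comp_add_mul _ (hηpos s hs).ne',
      intervalIntegral.integral_interval_sub_left (hdc.intervalIntegrable _ _)
        (hdc.intervalIntegrable _ _)]
    simp
  have hAC : ∀ s, 0 < s → ContDiffAt ℝ 1 A s := by
    intro s hs
    have h1 : ContDiffAt ℝ 1 (fun s => (η s)⁻¹ * (P (s + η s) - P s)) s := by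
      refine (hηC.contDiffAt.inv (hηpos s hs).ne').mul ?_
      exact ((hPC.comp (contDiff_id.add hηC)).sub hPC).contDiffAt
    refine h1.congr_of_eventuallyEq ?_
    filter_upwards [lt_mem_nhds hs] with t ht using hAP t ht
  refine ⟨fun s => A s + η s, by fun_prop, by simp [hA0, hη0], ?_, ?_, ?_, ?_, ?_⟩
  · exact fun s hs => (hAC s hs).add hηC.contDiffAt
  · exact fun s _ t _ hst => add_le_add (hAm s t hst) (hηm hst)
  · intro s hs
    have := hAl s hs
    rw [hd s hs] at this
    have := hηnn s hs
    simp only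
    linarith
  · intro s h1 h2
    have hs : 0 ≤ s := hMl.trans h1
    rcases hs.lt_or_eq with hs' | hs'
    · have h3 := hhG s (η s) h1 h2 (hηnn s hs) (hηlt s hs' h2)
      have h4 : k (A s + η s) ≤ k (d (s + η s) + η s) := hkm (by linarith [hAu s hs])
      rw [hk (A s + η s) (by linarith [hAl s hs, hdnn s hs, hηnn s hs])] at h4
      simp only at *
      linarith
    · subst hs'
      simp [hA0, hη0, hγ0]
  · intro a ha
    refine ⟨h a / (Mu + 1), div_pos (hhpos a ha) hC, ?_⟩
    intro s t h1 h2
    have := hηslope a s t h1 h2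
    have := hAm s t h2
    simp only
    linarith

theorem aux_dini {E : Type*} [NormedAddCommGroup E] [NormedSpace ℝ E] (V : E → ℝ)
    (hV : LocallyLipschitz V) (x : ℝ → E) (v : E) (t : ℝ)
    (hx : HasDerivWithinAt x v (Ici t) t) (lam r : ℝ) (hr : r < lam)
    (hd : dini V v (x t) ≤ ((-lam : ℝ) : EReal)) :
    ∀ᶠ s in 𝓝[>] t, V (x s) ≤ V (x t) - r * (s - t) := by
  obtain ⟨K, U, hU, hK⟩ := hV (x t)
  have hx' : HasDerivWithinAt x v (Ioi t) t := hx.mono Ioi_subset_Ici_self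
  -- the Dini derivative bound
  have h1 : ∀ᶠ τ in 𝓝[>] (0:ℝ), (V (x t + τ • v) - V (x t)) / τ < -((r + lam) / 2) := by
    have : dini V v (x t) < ((-((r + lam) / 2) : ℝ) : EReal) :=
      hd.trans_lt (by exact_mod_cast (by linarith))
    filter_upwards [eventually_lt_of_limsup_lt this] with τ hτ
    exact_mod_cast hτ
  have hsub : Tendsto (fun s => s - t) (𝓝[>] t) (𝓝[>] 0) := by
    refine tendsto_nhdsWithin_iff.2 ⟨?_, ?_⟩
    · have : Tendsto (fun s => s - t) (𝓝 t) (𝓝 (t - t)) := by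
        exact (continuous_id.sub continuous_const).tendsto t
      rw [sub_self] at this
      exact this.mono_left nhdsWithin_le_nhds
    · filter_upwards [self_mem_nhdsWithin] with s hs
      exact mem_Ioi.2 (sub_pos.2 (mem_Ioi.1 hs))
  have h1' := hsub.eventually h1
  -- points stay in the Lipschitz neighbourhood
  have h2 : ∀ᶠ s in 𝓝[>] t, x s ∈ U := hx'.continuousWithinAt hU
  have h3 : ∀ᶠ s in 𝓝[>] t, x t + (s - t) • v ∈ U := by
    have : Tendsto (fun s => x t + (s - t) • v) (𝓝 t) (𝓝 (x t + (t - t) • v)) :=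
      (continuous_const.add ((continuous_id.sub continuous_const).smul continuous_const)).tendsto t
    simp only [sub_self, zero_smul, add_zero] at this
    exact nhdsWithin_le_nhds (this hU)
  -- first order expansion
  have hε : 0 < (lam - r) / 2 / (K + 1) := div_pos (by linarith) (by positivity)
  have h4 := (hasDerivWithinAt_iff_isLittleO.1 hx').def hε
  filter_upwards [h1', h2, h3, h4, self_mem_nhdsWithin] with s g1 g2 g3 g4 g5
  have hst : 0 < s - t := sub_pos.2 g5
  rw [div_lt_iff₀ hst] at g1
  have h5 := hK.dist_le_mul _ g2 _ g3
  rw [Real.dist_eq, dist_eq_norm] at h5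
  have e : x s - (x t + (s - t) • v) = x s - x t - (s - t) • v := by abel
  rw [e] at h5
  rw [Real.norm_of_nonneg hst.le] at g4
  have h6 : (K:ℝ) * ‖x s - x t - (s - t) • v‖ ≤ (lam - r) / 2 * (s - t) := by
    calc (K:ℝ) * ‖x s - x t - (s - t) • v‖
        ≤ (K + 1) * ((lam - r) / 2 / (K + 1) * (s - t)) := by
          gcongr
          linarith
      _ = (lam - r) / 2 * (s - t) := by
          field_simp
  have := (le_abs_self _).trans (h5.trans h6)
  nlinarith

theorem aux_decay (u : ℝ → ℝ) (hu : ContinuousOn u (Ici 0)) (L M c : ℝ) (hLM : L ≤ M)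
    (hc : 0 < c) (h0 : u 0 ≤ M)
    (hdec : ∀ t, 0 ≤ t → L ≤ u t → u t ≤ M → ∀ᶠ s in 𝓝[>] t, u s ≤ u t - c * (s - t)) :
    ∀ᶠ t in atTop, u t ≤ L := by
  let B : ℝ → ℝ := fun t => max (M - c * t) L
  have hB : Continuous B := by fun_prop
  have key : ∀ T, 0 ≤ T → u T ≤ B T := by
    intro T hT
    have hcl : IsClosed ({t | u t ≤ B t} ∩ Icc 0 T) := by
      have := (isClosed_Icc (a := (0:ℝ)) (b := T)).isClosed_le
        (hu.mono Icc_subset_Ici_self) hB.continuousOn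
      convert this using 1
      ext t; simp [and_comm]
    have := hcl.Icc_subset_of_forall_exists_gt (a := 0) (b := T)
      (by simp [B, h0]) ?_
    · exact this ⟨hT, le_rfl⟩
    · rintro t ⟨htB, ht0, htT⟩ y hy
      have htB : u t ≤ B t := htB
      have hy' : ∀ᶠ s in 𝓝[>] t, s ∈ Ioc t y := Ioc_mem_nhdsGT hy
      suffices h : ∀ᶠ s in 𝓝[>] t, u s ≤ B s by
        obtain ⟨s, h1, h2⟩ := (h.and hy').exists
        exact ⟨s, h1, h2⟩
      rcases htB.lt_or_eq with h | h
      · have hc1 : ContinuousWithinAt u (Ioi t) t :=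
          (hu t ht0).mono fun s hs => ht0.trans (le_of_lt hs)
        have := hc1.eventually_lt hB.continuousWithinAt h
        filter_upwards [this] with s hs using hs.le
      · have hBM : B t ≤ M := max_le (by nlinarith) hLM
        have hBL : L ≤ B t := le_max_right _ _
        filter_upwards [hdec t ht0 (by linarith) (by linarith), self_mem_nhdsWithin] with s hs hst
        have hst : t < s := hst
        refine hs.trans ?_
        rw [h]
        rcases max_cases (M - c * t) L with ⟨h1, h2⟩ | ⟨h1, h2⟩
        · refine le_trans ?_ (le_max_left _ _)
          simp only [B]; rw [h1]; linarith
        · refine le_trans ?_ (le_max_right _ _)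
          simp only [B]; rw [h1]; nlinarith
  filter_upwards [eventually_ge_atTop ((M - L) / c), eventually_ge_atTop 0] with t ht ht0
  refine (key t ht0).trans (max_le ?_ le_rfl)
  rw [div_le_iff₀ hc] at ht
  linarith

theorem aux_compact {E : Type*} [NormedAddCommGroup E] [ProperSpace E] (V lam : E → ℝ)
    (hV : IsStorage V) (hl : Continuous lam) (hp : PosDefFun lam) (a b : ℝ) (ha : 0 < a) :
    ∃ c, 0 < c ∧ ∀ x, a ≤ V x → V x ≤ b → c ≤ lam x := by
  obtain ⟨hV0, hVL, al, be, hal, hbe, hab⟩ := hV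
  have hVc : Continuous V := hVL.continuous
  obtain ⟨R, hR⟩ := (hal.2.2.2.eventually (eventually_gt_atTop b)).exists_forall_of_atTop
  have hcomp : IsCompact {x : E | a ≤ V x ∧ V x ≤ b} := by
    refine (isCompact_closedBall (0:E) R).of_isClosed_subset ?_ ?_
    · exact (isClosed_le continuous_const hVc).inter (isClosed_le hVc continuous_const)
    · rintro x ⟨h1, h2⟩
      rw [mem_closedBall_zero_iff]
      by_contra hcon
      have := hR ‖x‖ (not_le.1 hcon).le
      linarith [(hab x).1]
  rcases Set.eq_empty_or_nonempty {x : E | a ≤ V x ∧ V x ≤ b} with he | hne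
  · refine ⟨1, one_pos, fun x h1 h2 => ?_⟩
    have : x ∈ {x : E | a ≤ V x ∧ V x ≤ b} := ⟨h1, h2⟩
    simp [he] at this
  · obtain ⟨x0, hx0, hmin⟩ := hcomp.exists_isMinOn hne hl.continuousOn
    refine ⟨lam x0, hp.2 x0 ?_, fun x h1 h2 => hmin ⟨h1, h2⟩⟩
    rintro rfl
    have h1 := (hab 0).2
    rw [norm_zero, hbe.2.2.1] at h1
    linarith [hx0.1]

theorem aux_zero {E : Type*} [NormedAddCommGroup E] (V : E → ℝ) (hV : IsStorage V) :
    PosDefFun V ∧ ProperFun V := by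
  obtain ⟨hV0, hVL, al, be, hal, hbe, hab⟩ := hV
  refine ⟨⟨?_, fun x hx => ?_⟩, fun C => ?_⟩
  · have h1 := (hab 0).2
    rw [norm_zero, hbe.2.2.1] at h1
    exact le_antisymm h1 (hV0 0)
  · have := hal.2.1 (show (0:ℝ) ∈ Ici 0 from mem_Ici.2 le_rfl) (mem_Ici.2 (norm_nonneg x)) (norm_pos_iff.2 hx)
    rw [hal.2.2.1] at this
    linarith [(hab x).1]
  · obtain ⟨R, hR⟩ := (hal.2.2.2.eventually (eventually_ge_atTop C)).exists_forall_of_atTop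
    exact ⟨R, fun y hy => (hR _ hy).trans (hab y).1⟩

/-- **Proposition 1** (region-dependent small gain attractivity). -/
theorem proposition1_region_dependent_small_gain
    (n m : ℕ) (hn : 1 ≤ n) (hm : 1 ≤ m)
    (V : EuclideanSpace ℝ (Fin n) → ℝ) (W : EuclideanSpace ℝ (Fin m) → ℝ)
    (hV : IsStorage V) (hW : IsStorage W)
    (f : EuclideanSpace ℝ (Fin n) × EuclideanSpace ℝ (Fin m) → EuclideanSpace ℝ (Fin n))
    (g : EuclideanSpace ℝ (Fin n) × EuclideanSpace ℝ (Fin m) → EuclideanSpace ℝ (Fin m))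
    (hf : ContDiff ℝ 1 f) (hg : ContDiff ℝ 1 g)
    (γ δ γinv : ℝ → ℝ) (hγ : ClassKInf γ) (hδ : ClassKInf δ)
    (hγinv₁ : ∀ s, 0 ≤ s → γinv (γ s) = s) (hγinv₂ : ∀ s, 0 ≤ s → γ (γinv s) = s)
    (lamx : EuclideanSpace ℝ (Fin n) → ℝ) (lamz : EuclideanSpace ℝ (Fin m) → ℝ)
    (hlamx : Continuous lamx ∧ PosDefFun lamx ∧ ProperFun lamx)
    (hlamz : Continuous lamz ∧ PosDefFun lamz ∧ ProperFun lamz)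
    (Ml Mu Nl Nu : ℝ)
    (hMl : 0 ≤ Ml) (hMlu : Ml < Mu) (hNl : 0 ≤ Nl) (hNlu : Nl < Nu)
    -- Assumption 1: the two ISS-Lyapunov implications hold on the region `S`
    (hA1 : ∀ p : EuclideanSpace ℝ (Fin n) × EuclideanSpace ℝ (Fin m),
      p ∈ ({p | Ml ≤ V p.1 ∧ V p.1 ≤ Mu ∧ W p.2 ≤ Nu} ∪
            {p | V p.1 ≤ Mu ∧ Nl ≤ W p.2 ∧ W p.2 ≤ Nu} :
              Set (EuclideanSpace ℝ (Fin n) × EuclideanSpace ℝ (Fin m))) →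
        (γ (W p.2) ≤ V p.1 → dini V (f p) p.1 ≤ ((-(lamx p.1) : ℝ) : EReal)) ∧
        (δ (V p.1) ≤ W p.2 → dini W (g p) p.2 ≤ ((-(lamz p.2) : ℝ) : EReal)))
    -- Assumption 2: regional small gain condition
    (hA2 : ∀ s : ℝ, Ml ≤ s → s ≤ Mu → s ≠ 0 → γ (δ s) < s)
    -- `M̃ < M̂`
    (hMM : max (γinv Ml) Nl < min (δ Mu) Nu) :
    ∃ U : EuclideanSpace ℝ (Fin n) × EuclideanSpace ℝ (Fin m) → ℝ,
      Continuous U ∧ ProperFun U ∧ PosDefFun U ∧ (∀ y, 0 ≤ U y) ∧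
      LocallyLipschitzOnSet U
        (({(0 : EuclideanSpace ℝ (Fin n) × EuclideanSpace ℝ (Fin m))} :
            Set (EuclideanSpace ℝ (Fin n) × EuclideanSpace ℝ (Fin m)))ᶜ) ∧
      ∀ y₀ : EuclideanSpace ℝ (Fin n) × EuclideanSpace ℝ (Fin m),
        U y₀ ≤ min (δ Mu) Nu → max (γinv Ml) Nl < U y₀ →
        ∀ Y : ℝ → EuclideanSpace ℝ (Fin n) × EuclideanSpace ℝ (Fin m),
          Y 0 = y₀ →
          (∀ t : ℝ, 0 ≤ t → HasDerivWithinAt Y (f (Y t), g (Y t)) (Set.Ici 0) t) →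
          Filter.limsup (fun t : ℝ => ((U (Y t) : ℝ) : EReal)) Filter.atTop
            ≤ ((max (γinv Ml) Nl : ℝ) : EReal) := by
  obtain ⟨σ, hσc, hσ0, hσC, hσm, hσδ, hσγ, hσs⟩ := aux_sigma γ δ hγ hδ Ml Mu hMl hMlu hA2
  obtain ⟨hVpd, hVpr⟩ := aux_zero V hV
  obtain ⟨hWpd, hWpr⟩ := aux_zero W hW
  have hVc : Continuous V := hV.2.1.continuous
  have hWc : Continuous W := hW.2.1.continuous
  have hV0 := hV.1
  have hW0 := hW.1
  have hδm : ∀ s t, 0 ≤ s → s ≤ t → δ s ≤ δ t := fun s t hs hst =>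
    hδ.2.1.monotoneOn (mem_Ici.2 hs) (mem_Ici.2 (hs.trans hst)) hst
  have hγm : ∀ s t, 0 ≤ s → s ≤ t → γ s ≤ γ t := fun s t hs hst =>
    hγ.2.1.monotoneOn (mem_Ici.2 hs) (mem_Ici.2 (hs.trans hst)) hst
  have hσm' : ∀ s t, 0 ≤ s → s ≤ t → σ s ≤ σ t := fun s t hs hst =>
    hσm (mem_Ici.2 hs) (mem_Ici.2 (hs.trans hst)) hst
  have hσpos : ∀ s, 0 < s → 0 < σ s := by
    intro s hs
    have h1 := hδ.2.1 (mem_Ici.2 le_rfl) (mem_Ici.2 hs.le) hs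
    rw [hδ.2.2.1] at h1
    exact h1.trans_le (hσδ s hs.le)
  have hσnn : ∀ s, 0 ≤ s → 0 ≤ σ s := fun s hs => hσ0 ▸ hσm' 0 s le_rfl hs
  have hσlt : ∀ s t, 0 ≤ s → 0 ≤ t → σ s < σ t → s < t := by
    intro s t hs ht h
    by_contra hcon
    exact absurd (hσm' t s ht (not_lt.1 hcon)) (not_le.2 h)
  have hσMu : δ Mu ≤ σ Mu := hσδ Mu (hMl.trans hMlu.le)
  have hσle : ∀ s, 0 ≤ s → σ s ≤ δ Mu → s ≤ Mu := by
    intro s hs h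
    by_contra hcon
    have hcon := not_le.1 hcon
    obtain ⟨c, hc, hcs⟩ := hσs Mu (hMl.trans_lt hMlu)
    have := hcs Mu s le_rfl hcon.le
    have := mul_pos hc (sub_pos.2 hcon)
    linarith
  -- `σ Ml ≤ γinv Ml`
  have hσMl : σ Ml ≤ γinv Ml := by
    obtain ⟨b, hb⟩ := ((hγ.2.2.2.eventually (eventually_ge_atTop Ml)).and
      (eventually_ge_atTop 0)).exists
    have hiv := intermediate_value_Icc hb.2 (hγ.1.mono Icc_subset_Ici_self)
    obtain ⟨s, hs, hsM⟩ := hiv ⟨by rw [hγ.2.2.1]; exact hMl, hb.1⟩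
    have h1 : γinv Ml = s := by rw [← hsM]; exact hγinv₁ s hs.1
    rw [h1]
    by_contra hcon
    have h2 := hγ.2.1 (mem_Ici.2 hs.1) (mem_Ici.2 (hs.1.trans (not_le.1 hcon).le)) (not_le.1 hcon)
    have h3 := hσγ Ml le_rfl hMlu.le
    linarith
  have hUc : Continuous (fun p : EuclideanSpace ℝ (Fin n) × EuclideanSpace ℝ (Fin m) =>
      max (σ (V p.1)) (W p.2)) := by fun_prop
  refine ⟨fun p => max (σ (V p.1)) (W p.2), hUc, ?_, ⟨?_, ?_⟩, ?_, ?_, ?_⟩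
  · -- proper
    intro C
    obtain ⟨s0, hs0⟩ := ((hδ.2.2.2.eventually (eventually_ge_atTop C)).and
      (eventually_ge_atTop 0)).exists
    obtain ⟨R1, hR1⟩ := hVpr s0
    obtain ⟨R2, hR2⟩ := hWpr C
    refine ⟨max R1 R2, fun y hy => ?_⟩
    rw [Prod.norm_def] at hy
    rcases le_max_iff.1 hy with h | h
    · refine le_trans ?_ (le_max_left _ _)
      exact hs0.1.trans ((hσδ s0 hs0.2).trans
        (hσm' _ _ hs0.2 (hR1 _ ((le_max_left _ _).trans h))))
    · exact (hR2 _ ((le_max_right _ _).trans h)).trans (le_max_right _ _)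
  · simp [hVpd.1, hWpd.1, hσ0]
  · rintro ⟨x, z⟩ hy
    by_cases hx : x = 0
    · have hz : z ≠ 0 := by
        rintro rfl; exact hy (by rw [hx]; rfl)
      exact lt_max_of_lt_right (hWpd.2 z hz)
    · exact lt_max_of_lt_left (hσpos _ (hVpd.2 x hx))
  · exact fun y => le_max_of_le_right (hW0 _)
  · -- locally Lipschitz
    rintro ⟨x, z⟩ hy
    have hfst := LipschitzWith.prod_fst (α := EuclideanSpace ℝ (Fin n))
      (β := EuclideanSpace ℝ (Fin m))
    have hsnd := LipschitzWith.prod_snd (α := EuclideanSpace ℝ (Fin n))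
      (β := EuclideanSpace ℝ (Fin m))
    have hWL : LocallyLipschitz
        (fun p : EuclideanSpace ℝ (Fin n) × EuclideanSpace ℝ (Fin m) => W p.2) :=
      hW.2.1.comp hsnd.locallyLipschitz
    have hVL : LocallyLipschitz
        (fun p : EuclideanSpace ℝ (Fin n) × EuclideanSpace ℝ (Fin m) => V p.1) :=
      hV.2.1.comp hfst.locallyLipschitz
    obtain ⟨K2, t2, ht2, hK2⟩ := hWL (x, z)
    by_cases hx : x = 0
    · have hz : z ≠ 0 := by
        rintro rfl; exact hy (by rw [hx]; rfl)
      have hlt : σ (V x) < W z := by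
        rw [hx, hVpd.1, hσ0]; exact hWpd.2 z hz
      have hev : ∀ᶠ p : EuclideanSpace ℝ (Fin n) × EuclideanSpace ℝ (Fin m) in 𝓝 (x, z),
          σ (V p.1) < W p.2 :=
        (isOpen_lt (by fun_prop) (by fun_prop)).mem_nhds hlt
      refine ⟨K2, _, mem_nhdsWithin_of_mem_nhds (inter_mem ht2 hev), ?_⟩
      intro p hp q hq
      have hp2 : σ (V p.1) < W p.2 := hp.2
      have hq2 : σ (V q.1) < W q.2 := hq.2
      simp only [max_eq_right hp2.le, max_eq_right hq2.le]
      exact hK2 hp.1 hq.1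
    · obtain ⟨K1, t1, ht1, hK1⟩ := hVL (x, z)
      obtain ⟨K3, t3, ht3, hK3⟩ := (hσC (V x) (hVpd.2 x hx)).exists_lipschitzOnWith
      have hpre : (fun p : EuclideanSpace ℝ (Fin n) × EuclideanSpace ℝ (Fin m) => V p.1) ⁻¹' t3
          ∈ 𝓝 (x, z) :=
        (show Continuous (fun p : EuclideanSpace ℝ (Fin n) × EuclideanSpace ℝ (Fin m) => V p.1)
          by fun_prop).continuousAt ht3
      refine ⟨max (K3 * K1) K2, (t1 ∩ (fun p : EuclideanSpace ℝ (Fin n) ×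
        EuclideanSpace ℝ (Fin m) => V p.1) ⁻¹' t3) ∩ t2,
        mem_nhdsWithin_of_mem_nhds (inter_mem (inter_mem ht1 hpre) ht2), ?_⟩
      have hA : LipschitzOnWith (K3 * K1)
          (fun p : EuclideanSpace ℝ (Fin n) × EuclideanSpace ℝ (Fin m) => σ (V p.1))
          ((t1 ∩ (fun p : EuclideanSpace ℝ (Fin n) ×
            EuclideanSpace ℝ (Fin m) => V p.1) ⁻¹' t3) ∩ t2) :=
        hK3.comp (hK1.mono (fun p hp => hp.1.1)) (fun p hp => hp.1.2)
      have hB := hK2.mono (s := (t1 ∩ (fun p : EuclideanSpace ℝ (Fin n) ×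
            EuclideanSpace ℝ (Fin m) => V p.1) ⁻¹' t3) ∩ t2) (fun p hp => hp.2)
      refine LipschitzOnWith.of_dist_le_mul fun p hp q hq => ?_
      have h1 := hA.dist_le_mul p hp q hq
      have h2 := hB.dist_le_mul p hp q hq
      rw [Real.dist_eq] at h1 h2 ⊢
      refine (abs_max_sub_max_le_max _ _ _ _).trans (max_le (h1.trans ?_) (h2.trans ?_))
      · gcongr
        exact_mod_cast le_max_left _ _
      · gcongr
        exact_mod_cast le_max_right _ _
  · -- dynamics
    intro y₀ hy₀ _ Y hY0 hY
    set Mt := max (γinv Ml) Nl with hMt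
    set Mh := min (δ Mu) Nu with hMh
    have hYc : ContinuousOn Y (Ici 0) := fun t ht => (hY t ht).continuousWithinAt
    have main : ∀ L : ℝ, Mt < L → L ≤ Mh → ∀ᶠ t in atTop,
        max (σ (V (Y t).1)) (W (Y t).2) ≤ L := by
      intro L hL hLM
      have hLl : γinv Ml < L := (le_max_left _ _).trans_lt hL
      have hLN : Nl < L := (le_max_right _ _).trans_lt hL
      have hL0 : 0 < L := hNl.trans_lt hLN
      -- lower bound on `V` in terms of `σ`
      obtain ⟨a, ha, haL⟩ : ∃ a, 0 < a ∧ σ a < L := by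
        have h1 : ∀ᶠ s in 𝓝[>] (0:ℝ), σ s < L :=
          nhdsWithin_le_nhds (hσc.continuousAt.eventually_lt continuousAt_const (by rwa [hσ0]))
        obtain ⟨a, h2, h3⟩ := (h1.and self_mem_nhdsWithin).exists
        exact ⟨a, h3, h2⟩
      obtain ⟨cx, hcx, hcx'⟩ := aux_compact V lamx hV hlamx.1 hlamx.2.1 a Mu ha
      obtain ⟨cz, hcz, hcz'⟩ := aux_compact W lamz hW hlamz.1 hlamz.2.1 L Nu hL0
      obtain ⟨cs, hcs, hcs'⟩ := hσs (a / 2) (by linarith)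
      have hc : 0 < min (cs * (cx / 2)) (cz / 2) := by positivity
      refine aux_decay (fun t => max (σ (V (Y t).1)) (W (Y t).2))
        (hUc.comp_continuousOn hYc) L Mh _ hLM hc (by rw [hY0]; exact hy₀) ?_
      intro t ht hLt htM
      have hYt : HasDerivWithinAt Y (f (Y t), g (Y t)) (Ici t) t :=
        (hY t ht).mono (Ici_subset_Ici.2 ht)
      have hxt : HasDerivWithinAt (fun s => (Y s).1) (f (Y t)) (Ici t) t :=
        (hasFDerivAt_fst (𝕜 := ℝ) (p := Y t)).comp_hasDerivWithinAt t hYt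
      have hzt : HasDerivWithinAt (fun s => (Y s).2) (g (Y t)) (Ici t) t :=
        (hasFDerivAt_snd (𝕜 := ℝ) (p := Y t)).comp_hasDerivWithinAt t hYt
      have hxc : ContinuousWithinAt (fun s => (Y s).1) (Ioi t) t :=
        hxt.continuousWithinAt.mono Ioi_subset_Ici_self
      have hzc : ContinuousWithinAt (fun s => (Y s).2) (Ioi t) t :=
        hzt.continuousWithinAt.mono Ioi_subset_Ici_self
      have hvc : ContinuousWithinAt (fun s => V (Y s).1) (Ioi t) t :=
        hVc.continuousAt.comp_continuousWithinAt hxc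
      have hσvc : ContinuousWithinAt (fun s => σ (V (Y s).1)) (Ioi t) t :=
        hσc.continuousAt.comp_continuousWithinAt hvc
      have hwc : ContinuousWithinAt (fun s => W (Y s).2) (Ioi t) t :=
        hWc.continuousAt.comp_continuousWithinAt hzc
      set u := max (σ (V (Y t).1)) (W (Y t).2) with hu
      set c := min (cs * (cx / 2)) (cz / 2) with hcdef
      have hlin : ContinuousWithinAt (fun s => u - c * (s - t)) (Ioi t) t := by
        apply Continuous.continuousWithinAt; fun_prop
      have hvM : V (Y t).1 ≤ Mu := hσle _ (hV0 _)
        ((le_max_left _ _).trans (htM.trans (min_le_left _ _)))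
      have hwN : W (Y t).2 ≤ Nu := (le_max_right _ _).trans (htM.trans (min_le_right _ _))
      have claimA : ∀ᶠ s in 𝓝[>] t, σ (V (Y s).1) ≤ u - c * (s - t) := by
        rcases lt_or_ge (σ (V (Y t).1)) (W (Y t).2) with hlt | hge
        · have h1 : σ (V (Y t).1) < u - c * (t - t) := by
            rw [sub_self, mul_zero, sub_zero]; exact hlt.trans_le (le_max_right _ _)
          filter_upwards [hσvc.eventually_lt hlin h1] with s hs using hs.le
        · have hue : u = σ (V (Y t).1) := max_eq_left hge
          have hav : a < V (Y t).1 := hσlt _ _ ha.le (hV0 _) (by linarith)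
          have hMv : Ml < V (Y t).1 := hσlt _ _ hMl (hV0 _) (by linarith)
          have hgam : γ (W (Y t).2) ≤ V (Y t).1 :=
            (hγm _ _ (hW0 _) hge).trans (hσγ _ hMv.le hvM)
          have hd := (hA1 (Y t) (Or.inl ⟨hMv.le, hvM, hwN⟩)).1 hgam
          have hlam := hcx' _ hav.le hvM
          have hev := aux_dini V hV.2.1 (fun s => (Y s).1) (f (Y t)) t hxt
            (lamx (Y t).1) (cx / 2) (by linarith) hd
          have hev2 : ∀ᶠ s in 𝓝[>] t, a / 2 < V (Y s).1 :=
            continuousWithinAt_const.eventually_lt hvc (by linarith)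
          filter_upwards [hev, hev2, self_mem_nhdsWithin] with s h1 h2 h3
          have h3 : 0 < s - t := sub_pos.2 h3
          have h4 : 0 < cx / 2 * (s - t) := by positivity
          have h5 := hcs' _ (V (Y t).1) h2.le (by linarith)
          have h6 : cs * (cx / 2 * (s - t)) ≤ cs * (V (Y t).1 - V (Y s).1) := by
            apply mul_le_mul_of_nonneg_left _ hcs.le
            linarith
          have h7 : c * (s - t) ≤ cs * (cx / 2) * (s - t) :=
            mul_le_mul_of_nonneg_right (min_le_left _ _) h3.le
          rw [hue]
          linarith
      have claimB : ∀ᶠ s in 𝓝[>] t, W (Y s).2 ≤ u - c * (s - t) := by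
        rcases lt_or_ge (W (Y t).2) (σ (V (Y t).1)) with hlt | hge
        · have h1 : W (Y t).2 < u - c * (t - t) := by
            rw [sub_self, mul_zero, sub_zero]; exact hlt.trans_le (le_max_left _ _)
          filter_upwards [hwc.eventually_lt hlin h1] with s hs using hs.le
        · have hue : u = W (Y t).2 := max_eq_right hge
          have hd := (hA1 (Y t) (Or.inr ⟨hvM, by linarith, hwN⟩)).2
            ((hσδ _ (hV0 _)).trans hge)
          have hlam := hcz' _ (by linarith) hwN
          have hev := aux_dini W hW.2.1 (fun s => (Y s).2) (g (Y t)) t hzt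
            (lamz (Y t).2) (cz / 2) (by linarith) hd
          filter_upwards [hev, self_mem_nhdsWithin] with s h1 h3
          have h3 : 0 < s - t := sub_pos.2 h3
          have h7 : c * (s - t) ≤ cz / 2 * (s - t) :=
            mul_le_mul_of_nonneg_right (min_le_right _ _) h3.le
          rw [hue]
          linarith
      filter_upwards [claimA, claimB] with s h1 h2 using max_le h1 h2
    by_contra hcon
    have hcon := not_le.1 hcon
    obtain ⟨L, hL1, hL2⟩ := EReal.lt_iff_exists_real_btwn.1 hcon
    have hL1 : Mt < L := by exact_mod_cast hL1
    have hev := main (min L Mh) (lt_min hL1 hMM) (min_le_right _ _)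
    refine absurd hL2 (not_lt.2 ?_)
    refine limsup_le_of_le (h := ?_)
    filter_upwards [hev] with t ht
    exact_mod_cast ht.trans (min_le_left _ _)
end
end

section
/- Proposition 1, explicit Lyapunov function. Let V be a storage function on ℝ^n and W a storage function on ℝ^m, let f ∈ C¹(ℝ^n × ℝ^m, ℝ^n), g ∈ C¹(ℝ^n × ℝ^m, ℝ^m), and suppose Assumption 1 (with class K∞ gains γ, δ, continuous positive definite proper λ_x, λ_z, and constants 0 ≤ M̲ < M̄ < ∞, 0 ≤ N̲ < N̄ < ∞) and Assumption 2 hold, that M̃ := max{γ⁻¹(M̲), N̲} < min{δ(M̄), N̄} =: M̂, and that in addition γ and δ are continuously differentiable with strictly positive derivative on (0,∞). Then the function U(x,z) := max{(δ(V(x)) + γ⁻¹(V(x)))/2, W(z)} is continuous, proper, positive definite, locally Lipschitz on (ℝ^n × ℝ^m) \ {(0,0)}, and for every y₀ ∈ Ω_{≤M̂}(U) \ Ω_{≤M̃}(U) and every forward-complete solution Y of the interconnected system with Y(0) = y₀, one has limsup_{t→∞} U(Y(t)) ≤ M̃. -/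
open Filter Topology Set

noncomputable section

lemma aux_traj {E : Type*} [NormedAddCommGroup E] [NormedSpace ℝ E] {V : E → ℝ}
    (hV : LocallyLipschitz V) {X : ℝ → E} {v : E} {t a b : ℝ} (ht : 0 ≤ t)
    (hX : HasDerivWithinAt X v (Set.Ici 0) t)
    (hd : dini V v (X t) ≤ ((b : ℝ) : EReal)) (hab : b < a) :
    ∀ᶠ s in 𝓝[>] t, V (X s) ≤ V (X t) + a * (s - t) := by
  obtain ⟨K, N, hN, hK⟩ := hV (X t)
  have hX' : HasDerivWithinAt X v (Set.Ioi t) t :=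
    hX.mono (fun s hs => ht.trans (le_of_lt hs))
  set a' := (a + b) / 2 with ha'
  have h1 : ∀ᶠ τ in 𝓝[>] (0:ℝ), (((V (X t + τ • v) - V (X t)) / τ : ℝ) : EReal) < (a' : ℝ) := by
    have hlt : dini V v (X t) < ((a' : ℝ) : EReal) := by
      refine lt_of_le_of_lt hd ?_
      exact_mod_cast (by linarith : b < a')
    exact Filter.eventually_lt_of_limsup_lt hlt
  have hshift : Tendsto (fun s : ℝ => s - t) (𝓝[>] t) (𝓝[>] (0:ℝ)) := by
    apply tendsto_nhdsWithin_of_tendsto_nhds_of_eventually_within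
    · have : Tendsto (fun s : ℝ => s - t) (𝓝 t) (𝓝 (t - t)) :=
        (continuous_id.sub continuous_const).tendsto t
      rw [sub_self] at this
      exact this.mono_left nhdsWithin_le_nhds
    · filter_upwards [self_mem_nhdsWithin] with s hs
      simpa using hs
  have h2 := hshift.eventually h1
  have hc1 : ∀ᶠ s in 𝓝[>] t, X s ∈ N := hX'.continuousWithinAt.eventually hN
  have hc2 : ∀ᶠ s in 𝓝[>] t, X t + (s - t) • v ∈ N := by
    have : Tendsto (fun s : ℝ => X t + (s - t) • v) (𝓝 t) (𝓝 (X t + (t - t) • v)) :=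
      (by fun_prop : Continuous (fun s : ℝ => X t + (s - t) • v)).tendsto t
    simp only [sub_self, zero_smul, add_zero] at this
    exact (this.mono_left nhdsWithin_le_nhds).eventually hN
  have ho := hasDerivWithinAt_iff_isLittleO.1 hX'
  have hpos : 0 < (a - b) / 2 / (K + 1) := by
    have : (0:ℝ) ≤ K := K.2
    apply div_pos <;> linarith
  have h3 := ho.def hpos
  filter_upwards [h2, hc1, hc2, h3, self_mem_nhdsWithin] with s h2 hc1 hc2 h3 hs
  have hs' : 0 < s - t := sub_pos.2 hs
  have h2' : (V (X t + (s - t) • v) - V (X t)) / (s - t) < a' := by exact_mod_cast h2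
  rw [div_lt_iff₀ hs'] at h2'
  have h4 := hK.dist_le_mul _ hc1 _ hc2
  rw [Real.dist_eq, dist_eq_norm] at h4
  have h5 : X s - (X t + (s - t) • v) = X s - X t - (s - t) • v := by abel
  rw [h5] at h4
  rw [Real.norm_eq_abs, abs_of_pos hs'] at h3
  have hK0 : (0:ℝ) ≤ K := K.2
  have h6 : (K:ℝ) * ((a - b) / 2 / (K + 1) * (s - t)) ≤ (a - b) / 2 * (s - t) := by
    have e : (K:ℝ) * ((a - b) / 2 / (K + 1) * (s - t)) = (K / (K+1)) * ((a - b) / 2 * (s - t)) := by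
      field_simp
    rw [e]
    have : (K:ℝ) / (K+1) ≤ 1 := by rw [div_le_one (by linarith)]; linarith
    have : 0 ≤ (a - b) / 2 * (s - t) := mul_nonneg (by linarith) hs'.le
    nlinarith
  have h7 := (le_abs_self _).trans (h4.trans ((mul_le_mul_of_nonneg_left h3 hK0).trans h6))
  rw [ha'] at h2'
  nlinarith

lemma aux_comp {σ q : ℝ → ℝ} {d a e t : ℝ} (hσ : MonotoneOn σ (Set.Ici 0))
    (hq : ∀ s, 0 ≤ q s) (hqt : 0 < q t) (hd : HasDerivAt σ d (q t))
    (hqa : ∀ᶠ s in 𝓝[>] t, q s ≤ q t + a * (s - t)) (he : d * a < e) :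
    ∀ᶠ s in 𝓝[>] t, σ (q s) ≤ σ (q t) + e * (s - t) := by
  have h0 : HasDerivAt (fun s : ℝ => q t + a * (s - t)) a t := by
    simpa using (((hasDerivAt_id t).sub_const t).const_mul a).const_add (q t)
  have h1 : HasDerivAt (fun s : ℝ => σ (q t + a * (s - t))) (d * a) t := by
    have hd' : HasDerivAt σ d ((fun s : ℝ => q t + a * (s - t)) t) := by simpa using hd
    exact hd'.comp t h0
  have h2 : ∀ᶠ s in 𝓝[>] t, slope (fun s : ℝ => σ (q t + a * (s - t))) t s < e :=
    (h1.hasDerivWithinAt (s := Set.Ioi t)).limsup_slope_le' (by simp) he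
  have h3 : ∀ᶠ s in 𝓝[>] t, 0 < q t + a * (s - t) := by
    have : ContinuousAt (fun s : ℝ => q t + a * (s - t)) t := h0.continuousAt
    exact nhdsWithin_le_nhds (this.eventually (lt_mem_nhds (by simpa using hqt)))
  filter_upwards [h2, h3, hqa, self_mem_nhdsWithin] with s h2 h3 hqa hs
  have hs' : 0 < s - t := sub_pos.2 hs
  rw [slope_def_field, div_lt_iff₀ hs'] at h2
  simp only [sub_self, mul_zero, add_zero] at h2
  have := hσ (hq s) h3.le hqa
  linarith

lemma aux_compare {u : ℝ → ℝ} {L M c : ℝ} (hu : ContinuousOn u (Set.Ici 0)) (hLM : L ≤ M)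
    (hc : 0 < c) (h0 : u 0 ≤ M)
    (hr : ∀ t, 0 ≤ t → L ≤ u t → u t ≤ M → ∀ᶠ s in 𝓝[>] t, u s ≤ u t - c * (s - t)) :
    ∀ t, 0 ≤ t → u t ≤ max L (M - c * t) := by
  intro b hb
  have hB : Continuous (fun t : ℝ => max L (M - c * t)) := by fun_prop
  have hub : ContinuousOn u (Set.Icc 0 b) := hu.mono (fun x hx => hx.1)
  have key : Set.Icc 0 b ⊆ {t | u t ≤ max L (M - c * t)} := by
    apply IsClosed.Icc_subset_of_forall_exists_gt
    · have : IsClosed {t ∈ Set.Icc 0 b | u t ≤ max L (M - c * t)} :=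
        isClosed_Icc.isClosed_le hub hB.continuousOn
      convert this using 1
      ext t; simp [and_comm]
    · simp [h0]
    · rintro x ⟨hx, hx0, hxb⟩ y hy
      have hx : u x ≤ max L (M - c * x) := hx
      have ev : ∀ᶠ s in 𝓝[>] x, u s ≤ max L (M - c * s) := by
        rcases hx.lt_or_eq with h | h
        · have h1 : ContinuousWithinAt u (Set.Ioi x) x :=
            (hu x hx0).mono (fun s hs => hx0.trans (le_of_lt hs))
          have h2 : ContinuousWithinAt (fun t : ℝ => max L (M - c * t)) (Set.Ioi x) x :=
            hB.continuousWithinAt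
          filter_upwards [h1.eventually_lt h2 h] with s hs using hs.le
        · have hle : u x ≤ M := by
            rw [h]; exact max_le hLM (by nlinarith)
          filter_upwards [hr x hx0 (by rw [h]; exact le_max_left _ _) hle, self_mem_nhdsWithin]
            with s hs hsx
          have hsx' : 0 < s - x := sub_pos.2 hsx
          rw [h] at hs
          refine hs.trans ?_
          rcases le_total L (M - c * x) with h' | h'
          · rw [max_eq_right h']
            exact le_trans (by linarith) (le_max_right _ _)
          · rw [max_eq_left h']
            exact le_trans (by nlinarith) (le_max_left _ _)
      obtain ⟨s, hs1, hs2⟩ := (ev.and (Ioc_mem_nhdsGT hy)).exists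
      exact ⟨s, hs1, hs2⟩
  exact key ⟨hb, le_rfl⟩

lemma aux_inv {γ γinv : ℝ → ℝ} (hγ : ClassKInf γ)
    (h1 : ∀ s, 0 ≤ s → γinv (γ s) = s) (h2 : ∀ s, 0 ≤ s → γ (γinv s) = s) :
    (∀ s, 0 ≤ s → 0 ≤ γinv s) ∧ StrictMonoOn γinv (Set.Ici 0) ∧ γinv 0 = 0 ∧
      ContinuousOn γinv (Set.Ici 0) := by
  obtain ⟨hc, hm, h0, ht⟩ := hγ
  have hsurj : ∀ s, 0 ≤ s → ∃ r, 0 ≤ r ∧ γ r = s := by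
    intro s hs
    obtain ⟨R, hR⟩ := (ht.eventually (eventually_ge_atTop s)).exists_forall_of_atTop
    have := intermediate_value_Icc (le_max_left 0 R) (hc.mono (fun x hx => hx.1))
    obtain ⟨r, hr, hrs⟩ := this ⟨by rw [h0]; exact hs, hR _ (le_max_right 0 R)⟩
    exact ⟨r, hr.1, hrs⟩
  have hnn : ∀ s, 0 ≤ s → 0 ≤ γinv s := by
    intro s hs
    obtain ⟨r, hr, rfl⟩ := hsurj s hs
    rwa [h1 r hr]
  have hγnn : ∀ s, 0 ≤ s → 0 ≤ γ s := fun s hs => by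
    have := hm.monotoneOn (by simp : (0:ℝ) ∈ Set.Ici 0) hs hs
    rwa [h0] at this
  have hmono : StrictMonoOn γinv (Set.Ici 0) := by
    intro x hx y hy hxy
    rw [← hm.lt_iff_lt (hnn x hx) (hnn y hy), h2 x hx, h2 y hy]
    exact hxy
  have hz : γinv 0 = 0 := by have := h1 0 le_rfl; rwa [h0] at this
  refine ⟨hnn, hmono, hz, ?_⟩
  have him : γinv '' (Set.Ici 0) = Set.Ici 0 := by
    ext r; constructor
    · rintro ⟨s, hs, rfl⟩; exact hnn s hs
    · intro hr; exact ⟨γ r, hγnn r hr, h1 r hr⟩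
  intro s hs
  rcases (show (0:ℝ) ≤ s from hs).eq_or_lt with rfl | hs
  · apply continuousWithinAt_right_of_monotoneOn_of_image_mem_nhdsWithin hmono.monotoneOn
      self_mem_nhdsWithin
    rw [him, hz]; exact self_mem_nhdsWithin
  · refine (continuousAt_of_monotoneOn_of_image_mem_nhds hmono.monotoneOn
      (Ici_mem_nhds hs) ?_).continuousWithinAt
    rw [him]
    apply Ici_mem_nhds
    have := hmono (by simp : (0:ℝ) ∈ Set.Ici 0) hs.le hs
    rwa [hz] at this

lemma aux_inv_C1 {γ γinv : ℝ → ℝ} (hγ : ClassKInf γ)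
    (h1 : ∀ s, 0 ≤ s → γinv (γ s) = s) (h2 : ∀ s, 0 ≤ s → γ (γinv s) = s)
    (hC : ContDiffOn ℝ 1 γ (Set.Ioi 0)) (hp : ∀ s : ℝ, 0 < s → 0 < deriv γ s) :
    ContinuousOn (fun s => (deriv γ (γinv s))⁻¹) (Set.Ioi 0) ∧
    ∀ s, 0 < s → HasDerivAt γinv (deriv γ (γinv s))⁻¹ s := by
  obtain ⟨hnn, hmono, hz, hcont⟩ := aux_inv hγ h1 h2
  have hpos : ∀ s, 0 < s → 0 < γinv s := by
    intro s hs
    have := hmono (by simp : (0:ℝ) ∈ Set.Ici 0) hs.le hs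
    rwa [hz] at this
  have hd : ContinuousOn (deriv γ) (Set.Ioi 0) := hC.continuousOn_deriv_of_isOpen isOpen_Ioi le_rfl
  constructor
  · apply ContinuousOn.inv₀
    · exact hd.comp (hcont.mono Ioi_subset_Ici_self) (fun s hs => hpos s hs)
    · intro s hs; exact (hp _ (hpos s hs)).ne'
  · intro s hs
    have hdiff : HasDerivAt γ (deriv γ (γinv s)) (γinv s) :=
      ((hC.differentiableOn one_ne_zero).differentiableAt (Ioi_mem_nhds (hpos s hs))).hasDerivAt
    refine hdiff.of_local_left_inverse (hcont.continuousAt (Ici_mem_nhds hs))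
      (hp _ (hpos s hs)).ne' ?_
    filter_upwards [Ioi_mem_nhds hs] with r hr using h2 r (le_of_lt hr)

lemma aux_storage {E : Type*} [NormedAddCommGroup E] {V : E → ℝ} (hV : IsStorage V) :
    V 0 = 0 ∧ (∀ x, x ≠ 0 → 0 < V x) ∧ ProperFun V := by
  obtain ⟨hnn, -, a, b, ⟨-, ham, ha0, hat⟩, ⟨-, -, hb0, -⟩, hab⟩ := hV
  refine ⟨?_, ?_, ?_⟩
  · have := (hab 0).2
    rw [norm_zero, hb0] at this
    exact le_antisymm this (hnn 0)
  · intro x hx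
    have := ham (by simp : (0:ℝ) ∈ Set.Ici 0) (norm_nonneg x) (norm_pos_iff.2 hx)
    rw [ha0] at this
    exact this.trans_le (hab x).1
  · intro C
    obtain ⟨R, hR⟩ := (hat.eventually (eventually_ge_atTop C)).exists_forall_of_atTop
    exact ⟨R, fun y hy => (hR _ hy).trans (hab y).1⟩

/-- **Proposition 1, explicit Lyapunov function.** -/
theorem proposition1_explicit_lyapunov_function
    (n m : ℕ) (hn : 1 ≤ n) (hm : 1 ≤ m)
    (V : EuclideanSpace ℝ (Fin n) → ℝ) (W : EuclideanSpace ℝ (Fin m) → ℝ)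
    (hV : IsStorage V) (hW : IsStorage W)
    (f : EuclideanSpace ℝ (Fin n) × EuclideanSpace ℝ (Fin m) → EuclideanSpace ℝ (Fin n))
    (g : EuclideanSpace ℝ (Fin n) × EuclideanSpace ℝ (Fin m) → EuclideanSpace ℝ (Fin m))
    (hf : ContDiff ℝ 1 f) (hg : ContDiff ℝ 1 g)
    (γ δ γinv : ℝ → ℝ) (hγ : ClassKInf γ) (hδ : ClassKInf δ)
    (hγinv₁ : ∀ s, 0 ≤ s → γinv (γ s) = s) (hγinv₂ : ∀ s, 0 ≤ s → γ (γinv s) = s)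
    -- γ and δ are continuously differentiable with strictly positive derivative on (0,∞)
    (hγC1 : ContDiffOn ℝ 1 γ (Set.Ioi 0)) (hγ' : ∀ s : ℝ, 0 < s → 0 < deriv γ s)
    (hδC1 : ContDiffOn ℝ 1 δ (Set.Ioi 0)) (hδ' : ∀ s : ℝ, 0 < s → 0 < deriv δ s)
    (lamx : EuclideanSpace ℝ (Fin n) → ℝ) (lamz : EuclideanSpace ℝ (Fin m) → ℝ)
    (hlamx : Continuous lamx ∧ PosDefFun lamx ∧ ProperFun lamx)
    (hlamz : Continuous lamz ∧ PosDefFun lamz ∧ ProperFun lamz)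
    (Ml Mu Nl Nu : ℝ)
    (hMl : 0 ≤ Ml) (hMlu : Ml < Mu) (hNl : 0 ≤ Nl) (hNlu : Nl < Nu)
    -- Assumption 1: the two ISS-Lyapunov implications hold on the region `S`
    (hA1 : ∀ p : EuclideanSpace ℝ (Fin n) × EuclideanSpace ℝ (Fin m),
      p ∈ ({p | Ml ≤ V p.1 ∧ V p.1 ≤ Mu ∧ W p.2 ≤ Nu} ∪
            {p | V p.1 ≤ Mu ∧ Nl ≤ W p.2 ∧ W p.2 ≤ Nu} :
              Set (EuclideanSpace ℝ (Fin n) × EuclideanSpace ℝ (Fin m))) →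
        (γ (W p.2) ≤ V p.1 → dini V (f p) p.1 ≤ ((-(lamx p.1) : ℝ) : EReal)) ∧
        (δ (V p.1) ≤ W p.2 → dini W (g p) p.2 ≤ ((-(lamz p.2) : ℝ) : EReal)))
    -- Assumption 2: regional small gain condition
    (hA2 : ∀ s : ℝ, Ml ≤ s → s ≤ Mu → s ≠ 0 → γ (δ s) < s)
    -- `M̃ < M̂`
    (hMM : max (γinv Ml) Nl < min (δ Mu) Nu)
    -- the explicit function `U`
    (U : EuclideanSpace ℝ (Fin n) × EuclideanSpace ℝ (Fin m) → ℝ)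
    (hUdef : ∀ p : EuclideanSpace ℝ (Fin n) × EuclideanSpace ℝ (Fin m),
      U p = max ((δ (V p.1) + γinv (V p.1)) / 2) (W p.2)) :
    Continuous U ∧ ProperFun U ∧ PosDefFun U ∧
    LocallyLipschitzOnSet U
      (({(0 : EuclideanSpace ℝ (Fin n) × EuclideanSpace ℝ (Fin m))} :
          Set (EuclideanSpace ℝ (Fin n) × EuclideanSpace ℝ (Fin m)))ᶜ) ∧
    ∀ y₀ : EuclideanSpace ℝ (Fin n) × EuclideanSpace ℝ (Fin m),
      U y₀ ≤ min (δ Mu) Nu → max (γinv Ml) Nl < U y₀ →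
      ∀ Y : ℝ → EuclideanSpace ℝ (Fin n) × EuclideanSpace ℝ (Fin m),
        Y 0 = y₀ →
        (∀ t : ℝ, 0 ≤ t → HasDerivWithinAt Y (f (Y t), g (Y t)) (Set.Ici 0) t) →
        Filter.limsup (fun t : ℝ => ((U (Y t) : ℝ) : EReal)) Filter.atTop
          ≤ ((max (γinv Ml) Nl : ℝ) : EReal) := by
  obtain ⟨hinn, himono, hi0, hicont⟩ := aux_inv hγ hγinv₁ hγinv₂
  obtain ⟨hidc, hid⟩ := aux_inv_C1 hγ hγinv₁ hγinv₂ hγC1 hγ'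
  obtain ⟨hV0, hVpos, hVprop⟩ := aux_storage hV
  obtain ⟨hW0, hWpos, hWprop⟩ := aux_storage hW
  obtain ⟨hVnn, hVL, -⟩ := hV
  obtain ⟨hWnn, hWL, -⟩ := hW
  obtain ⟨hγc, hγm, hγ0, hγt⟩ := hγ
  obtain ⟨hδc, hδm, hδ0, hδt⟩ := hδ
  have z0 : (0:ℝ) ∈ Set.Ici (0:ℝ) := by simp
  have hδnn : ∀ s, 0 ≤ s → 0 ≤ δ s := fun s hs => by
    have := hδm.monotoneOn z0 hs hs
    rwa [hδ0] at this
  obtain ⟨σ, hσ⟩ : ∃ σ : ℝ → ℝ, ∀ s, σ s = (δ s + γinv s) / 2 := ⟨_, fun _ => rfl⟩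
  obtain ⟨σ', hσ'⟩ : ∃ σ' : ℝ → ℝ, ∀ s, σ' s = (deriv δ s + (deriv γ (γinv s))⁻¹) / 2 :=
    ⟨_, fun _ => rfl⟩
  have hU : ∀ p, U p = max (σ (V p.1)) (W p.2) := fun p => by rw [hUdef, hσ]
  have hσfun : σ = fun s => (δ s + γinv s) / 2 := funext hσ
  have hσ'fun : σ' = fun s => (deriv δ s + (deriv γ (γinv s))⁻¹) / 2 := funext hσ'
  have hσm : StrictMonoOn σ (Set.Ici 0) := by
    intro x hx y hy hxy
    have h1 := hδm hx hy hxy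
    have h2 := himono hx hy hxy
    rw [hσ, hσ]; linarith
  have hσ0 : σ 0 = 0 := by rw [hσ, hδ0, hi0]; simp
  have hσnn : ∀ s, 0 ≤ s → 0 ≤ σ s := fun s hs => by
    have := hσm.monotoneOn z0 hs hs
    rwa [hσ0] at this
  have hσc : ContinuousOn σ (Set.Ici 0) := by
    rw [hσfun]; exact (hδc.add hicont).div_const 2
  have hδd : ContinuousOn (deriv δ) (Set.Ioi 0) :=
    hδC1.continuousOn_deriv_of_isOpen isOpen_Ioi le_rfl
  have hσ'c : ContinuousOn σ' (Set.Ioi 0) := by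
    rw [hσ'fun]; exact (hδd.add hidc).div_const 2
  have hipos : ∀ s, 0 < s → 0 < γinv s := by
    intro s hs
    have := himono z0 hs.le hs
    rwa [hi0] at this
  have hσ'pos : ∀ s, 0 < s → 0 < σ' s := by
    intro s hs
    have h1 := hδ' s hs
    have h2 := inv_pos.2 (hγ' _ (hipos s hs))
    rw [hσ']; linarith
  have hσd : ∀ s, 0 < s → HasDerivAt σ (σ' s) s := by
    intro s hs
    have h1 : HasDerivAt δ (deriv δ s) s :=
      ((hδC1.differentiableOn one_ne_zero).differentiableAt (Ioi_mem_nhds hs)).hasDerivAt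
    rw [hσfun, hσ']
    exact (h1.add (hid s hs)).div_const 2
  have hVc : Continuous V := hVL.continuous
  have hWc : Continuous W := hWL.continuous
  have hσVc : Continuous (fun x => σ (V x)) := hσc.comp_continuous hVc (fun x => hVnn x)
  have hUc : Continuous U := by
    have : U = fun p => max (σ (V p.1)) (W p.2) := funext hU
    rw [this]
    exact (hσVc.comp continuous_fst).max (hWc.comp continuous_snd)
  have hUprop : ProperFun U := by
    intro C
    obtain ⟨R2, hR2⟩ := (hδt.eventually (eventually_ge_atTop (2 * C))).exists_forall_of_atTop
    obtain ⟨R1, hR1⟩ := hVprop R2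
    obtain ⟨R3, hR3⟩ := hWprop C
    refine ⟨max R1 R3, fun y hy => ?_⟩
    rw [hU]
    rw [Prod.norm_def] at hy
    rcases le_total ‖y.1‖ ‖y.2‖ with h | h
    · rw [max_eq_right h] at hy
      exact (hR3 _ ((le_max_right _ _).trans hy)).trans (le_max_right _ _)
    · rw [max_eq_left h] at hy
      have h1 := hR2 _ (hR1 _ ((le_max_left _ _).trans hy))
      have h2 := hinn _ (hVnn y.1)
      refine le_trans ?_ (le_max_left _ _)
      rw [hσ]; linarith
  have hUpd : PosDefFun U := by
    constructor
    · rw [hU]; simp [hV0, hW0, hσ0]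
    · intro y hy
      rw [hU]
      by_cases h : y.1 = 0
      · have h2 : y.2 ≠ 0 := fun h2 => hy (Prod.ext h h2)
        exact (hWpos _ h2).trans_le (le_max_right _ _)
      · have := hσm z0 (hVnn y.1) (hVpos _ h)
        rw [hσ0] at this
        exact this.trans_le (le_max_left _ _)
  refine ⟨hUc, hUprop, hUpd, ?_, ?_⟩
  · intro y hy
    have hy : y ≠ 0 := hy
    suffices h : ∃ K : NNReal, ∃ t ∈ 𝓝 y, LipschitzOnWith K U t by
      obtain ⟨K, t, ht, h⟩ := h
      exact ⟨K, t, mem_nhdsWithin_of_mem_nhds ht, h⟩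
    obtain ⟨KW, tW, htW, hKW⟩ := hWL y.2
    have hW' : LipschitzOnWith (KW * 1) (fun p : EuclideanSpace ℝ (Fin n) × EuclideanSpace ℝ (Fin m) => W p.2)
        (Prod.snd ⁻¹' tW) :=
      hKW.comp (LipschitzWith.prod_snd.lipschitzOnWith) (fun p hp => hp)
    have htW' : Prod.snd ⁻¹' tW ∈ 𝓝 y := continuous_snd.continuousAt.preimage_mem_nhds htW
    by_cases h : y.1 = 0
    · have h2 : y.2 ≠ 0 := fun h2 => hy (Prod.ext h h2)
      have hlt : σ (V y.1) < W y.2 := by rw [h, hV0, hσ0]; exact hWpos _ h2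
      have hev : {p : EuclideanSpace ℝ (Fin n) × EuclideanSpace ℝ (Fin m) | σ (V p.1) < W p.2} ∈ 𝓝 y :=
        (isOpen_lt (hσVc.comp continuous_fst) (hWc.comp continuous_snd)).mem_nhds hlt
      refine ⟨KW * 1, _, inter_mem htW' hev, ?_⟩
      intro p hp q hq
      have e1 : U p = W p.2 := by rw [hU]; exact max_eq_right (le_of_lt hp.2)
      have e2 : U q = W q.2 := by rw [hU]; exact max_eq_right (le_of_lt hq.2)
      rw [e1, e2]
      exact hW' hp.1 hq.1
    · have hvp := hVpos _ h
      have hstrict : ContDiffAt ℝ 1 σ (V y.1) := by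
        have hco : ContDiffOn ℝ 1 σ (Set.Ioi 0) := by
          have h01 : (1 : WithTop ℕ∞) = 0 + 1 := by simp
          rw [h01, contDiffOn_succ_iff_deriv_of_isOpen isOpen_Ioi]
          refine ⟨fun s hs => (hσd s hs).differentiableAt.differentiableWithinAt, by simp, ?_⟩
          rw [contDiffOn_zero]
          exact hσ'c.congr (fun s hs => (hσd s hs).deriv)
        exact hco.contDiffAt (Ioi_mem_nhds hvp)
      obtain ⟨Kσ, tσ, htσ, hKσ⟩ := hstrict.exists_lipschitzOnWith
      obtain ⟨KV, tV, htV, hKV⟩ := hVL y.1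
      have hV' : LipschitzOnWith (Kσ * KV) (fun x => σ (V x)) (tV ∩ V ⁻¹' tσ) :=
        hKσ.comp (hKV.mono inter_subset_left) (fun p hp => hp.2)
      have hV'' : LipschitzOnWith (Kσ * KV * 1) (fun p : EuclideanSpace ℝ (Fin n) × EuclideanSpace ℝ (Fin m) => σ (V p.1))
          (Prod.fst ⁻¹' (tV ∩ V ⁻¹' tσ)) :=
        hV'.comp (LipschitzWith.prod_fst.lipschitzOnWith) (fun p hp => hp)
      have htV' : Prod.fst ⁻¹' (tV ∩ V ⁻¹' tσ) ∈ 𝓝 y :=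
        continuous_fst.continuousAt.preimage_mem_nhds
          (inter_mem htV (hVc.continuousAt.preimage_mem_nhds htσ))
      refine ⟨max (Kσ * KV * 1) (KW * 1), _, inter_mem htV' htW', ?_⟩
      apply LipschitzOnWith.of_dist_le_mul
      intro p hp q hq
      have a1 := hV''.dist_le_mul p hp.1 q hq.1
      have a2 := hW'.dist_le_mul p hp.2 q hq.2
      rw [hU, hU]
      rw [Real.dist_eq] at a1 a2 ⊢
      refine (abs_max_sub_max_le_max _ _ _ _).trans (max_le ?_ ?_)
      · refine a1.trans (mul_le_mul_of_nonneg_right ?_ dist_nonneg)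
        exact_mod_cast le_max_left _ _
      · refine a2.trans (mul_le_mul_of_nonneg_right ?_ dist_nonneg)
        exact_mod_cast le_max_right _ _
  · intro y₀ hy1 hy2 Y hY0 hY
    set Mt := max (γinv Ml) Nl with hMt
    set Mh := min (δ Mu) Nu with hMh
    have hMu : 0 < Mu := hMl.trans_lt hMlu
    have hMt0 : 0 ≤ Mt := hNl.trans (le_max_right _ _)
    -- small gain in inverse form
    have hsg : ∀ s, Ml ≤ s → s ≤ Mu → 0 < s → δ s < γinv s := by
      intro s h1 h2 h3
      rw [← hγm.lt_iff_lt (hδnn s h3.le) (hinn s h3.le), hγinv₂ s h3.le]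
      exact hA2 s h1 h2 h3.ne'
    have hδMl : δ Ml ≤ γinv Ml := by
      rcases hMl.eq_or_lt with h | h
      · rw [← h, hδ0, hi0]
      · exact (hsg Ml le_rfl hMlu.le h).le
    have hVMu : ∀ p, U p ≤ Mh → V p.1 < Mu := by
      intro p hp
      rw [← hσm.lt_iff_lt (hVnn _) hMu.le]
      have h1 : σ (V p.1) ≤ δ Mu := by
        have := le_max_left (σ (V p.1)) (W p.2)
        rw [← hU] at this
        exact this.trans (hp.trans (min_le_left _ _))
      have h2 := hsg Mu hMlu.le le_rfl hMu
      rw [hσ Mu]; linarith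
    have hWNu : ∀ p, U p ≤ Mh → W p.2 ≤ Nu := by
      intro p hp
      have := le_max_right (σ (V p.1)) (W p.2)
      rw [← hU] at this
      exact this.trans (hp.trans (min_le_right _ _))
    have hVMl : ∀ p : EuclideanSpace ℝ (Fin n) × EuclideanSpace ℝ (Fin m), Mt < σ (V p.1) → Ml < V p.1 := by
      intro p hp
      rw [← hσm.lt_iff_lt hMl (hVnn _)]
      have : γinv Ml ≤ Mt := le_max_left _ _
      rw [hσ Ml]; linarith
    have hdx : ∀ p, Mt < U p → U p ≤ Mh → W p.2 ≤ σ (V p.1) →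
        dini V (f p) p.1 ≤ ((-(lamx p.1) : ℝ) : EReal) := by
      intro p h1 h2 h3
      rw [hU, max_eq_left h3] at h1
      have hl := hVMl p h1
      have hu := hVMu p h2
      have hs := hsg _ hl.le hu.le (hMl.trans_lt hl)
      refine (hA1 p (Or.inl ⟨hl.le, hu.le, hWNu p h2⟩)).1 ?_
      rw [← hγinv₂ (V p.1) (hVnn _)]
      refine hγm.monotoneOn (hWnn _) (hinn _ (hVnn _)) ?_
      rw [hσ] at h3; linarith
    have hdz : ∀ p, Mt < U p → U p ≤ Mh → σ (V p.1) ≤ W p.2 →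
        dini W (g p) p.2 ≤ ((-(lamz p.2) : ℝ) : EReal) := by
      intro p h1 h2 h3
      rw [hU, max_eq_right h3] at h1
      have hu := hVMu p h2
      have hNl' : Nl ≤ Mt := le_max_right _ _
      refine (hA1 p (Or.inr ⟨hu.le, by linarith, hWNu p h2⟩)).2 ?_
      rcases lt_or_ge Ml (V p.1) with h | h
      · have hs := hsg _ h.le hu.le (hMl.trans_lt h)
        rw [hσ] at h3; linarith
      · have ha := hδm.monotoneOn (hVnn p.1) hMl h
        have hb : γinv Ml ≤ Mt := le_max_left _ _
        linarith
    have hYc : ContinuousOn Y (Set.Ici 0) := fun t ht => (hY t ht).continuousWithinAt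
    have main : ∀ L, Mt < L → L ≤ Mh → ∀ᶠ t in atTop, U (Y t) ≤ L := by
      intro L hL1 hL2
      have hKcl : IsClosed {p | L ≤ U p ∧ U p ≤ Mh} :=
        (isClosed_le continuous_const hUc).inter (isClosed_le hUc continuous_const)
      have hKc : IsCompact {p | L ≤ U p ∧ U p ≤ Mh} := by
        obtain ⟨R, hR⟩ := hUprop (Mh + 1)
        refine Metric.isCompact_of_isClosed_isBounded hKcl
          ((Metric.isBounded_closedBall (x := 0) (r := R)).subset ?_)
        rintro p ⟨-, hp⟩
        rw [mem_closedBall_zero_iff]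
        by_contra hcon
        have := hR p (le_of_lt (not_le.1 hcon))
        linarith
      have hK1 : IsCompact ({p | L ≤ U p ∧ U p ≤ Mh} ∩ {p | W p.2 ≤ σ (V p.1)}) :=
        hKc.inter_right (isClosed_le (hWc.comp continuous_snd) (hσVc.comp continuous_fst))
      have hK2 : IsCompact ({p | L ≤ U p ∧ U p ≤ Mh} ∩ {p | σ (V p.1) ≤ W p.2}) :=
        hKc.inter_right (isClosed_le (hσVc.comp continuous_fst) (hWc.comp continuous_snd))
      have hVpos1 : ∀ p, L ≤ U p → W p.2 ≤ σ (V p.1) → 0 < V p.1 := by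
        intro p h1 h2
        rw [hU, max_eq_left h2] at h1
        exact hMl.trans_lt (hVMl p (hL1.trans_le h1))
      have hcφ : ContinuousOn
          (fun p : EuclideanSpace ℝ (Fin n) × EuclideanSpace ℝ (Fin m) => σ' (V p.1) * lamx p.1)
          ({p | L ≤ U p ∧ U p ≤ Mh} ∩ {p | W p.2 ≤ σ (V p.1)}) := by
        refine ContinuousOn.mul ?_ (hlamx.1.comp continuous_fst).continuousOn
        refine hσ'c.comp (t := Set.Ioi 0) (hVc.comp continuous_fst).continuousOn ?_
        intro p hp
        exact hVpos1 p hp.1.1 hp.2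
      obtain ⟨c1, hc1, hc1'⟩ := hK1.exists_forall_le' (a := 0) hcφ
        (by
          intro p hp
          have h := hVpos1 p hp.1.1 hp.2
          refine mul_pos (hσ'pos _ h) (hlamx.2.1.2 _ ?_)
          intro h0; rw [h0, hV0] at h; exact lt_irrefl _ h)
      obtain ⟨c2, hc2, hc2'⟩ := hK2.exists_forall_le' (f := fun p => lamz p.2) (a := 0)
        (hlamz.1.comp continuous_snd).continuousOn
        (by
          intro p hp
          refine hlamz.2.1.2 _ ?_
          intro h0
          have h1 := hp.1.1
          have h2 : σ (V p.1) ≤ W p.2 := hp.2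
          rw [hU, max_eq_right h2, h0, hW0] at h1
          linarith)
      set c := min c1 c2 / 2 with hc
      have hcpos : 0 < c := half_pos (lt_min hc1 hc2)
      have hcc1 : c < c1 := by have := min_le_left c1 c2; linarith
      have hcc2 : c < c2 := by have := min_le_right c1 c2; linarith
      have huc : ContinuousOn (fun t => U (Y t)) (Set.Ici 0) := hUc.comp_continuousOn hYc
      have hcmp := aux_compare (u := fun t => U (Y t)) huc hL2 hcpos (by simpa [hY0] using hy1) (by
        intro t ht hLt hMt'
        have hsub : Set.Ioi t ⊆ Set.Ici 0 := fun s hs => ht.trans (le_of_lt hs)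
        have hYt : ContinuousWithinAt Y (Set.Ioi t) t := (hYc t ht).mono hsub
        have hlin : ContinuousWithinAt (fun s => U (Y t) - c * (s - t)) (Set.Ioi t) t := by
          apply Continuous.continuousWithinAt; fun_prop
        have hX : HasDerivWithinAt (fun s => (Y s).1) (f (Y t)) (Set.Ici 0) t :=
          (hY t ht).fst
        have hZ : HasDerivWithinAt (fun s => (Y s).2) (g (Y t)) (Set.Ici 0) t :=
          (hY t ht).snd
        have e1 : ∀ᶠ s in 𝓝[>] t, σ (V (Y s).1) ≤ U (Y t) - c * (s - t) := by
          rcases lt_or_ge (σ (V (Y t).1)) (W (Y t).2) with h | h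
          · have hcw : ContinuousWithinAt (fun s => σ (V (Y s).1)) (Set.Ioi t) t :=
              (hσVc.comp continuous_fst).continuousAt.comp_continuousWithinAt hYt
            have := hcw.eventually_lt hlin (by
              beta_reduce; rw [sub_self, mul_zero, sub_zero, hU, max_eq_right h.le]; exact h)
            filter_upwards [this] with s hs using hs.le
          · have hv := hVpos1 _ hLt h
            have hd := hdx (Y t) (hL1.trans_le hLt) hMt' h
            have hb : c1 ≤ σ' (V (Y t).1) * lamx (Y t).1 := hc1' (Y t) ⟨⟨hLt, hMt'⟩, h⟩
            have hsp := hσ'pos _ hv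
            have hab : -(lamx (Y t).1) < -(c + c1) / 2 / σ' (V (Y t).1) := by
              rw [lt_div_iff₀ hsp]; nlinarith
            have h1 := aux_traj hVL ht hX hd hab
            have h2 := aux_comp (q := fun s => V (Y s).1) (e := -c) hσm.monotoneOn
              (fun s => hVnn _) hv (hσd _ hv) h1 (by
                rw [mul_div_cancel₀ _ hsp.ne']; linarith)
            rw [hU (Y t), max_eq_left h]
            filter_upwards [h2] with s hs
            linarith
        have e2 : ∀ᶠ s in 𝓝[>] t, W (Y s).2 ≤ U (Y t) - c * (s - t) := by
          rcases lt_or_ge (W (Y t).2) (σ (V (Y t).1)) with h | h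
          · have hcw : ContinuousWithinAt (fun s => W (Y s).2) (Set.Ioi t) t :=
              (hWc.comp continuous_snd).continuousAt.comp_continuousWithinAt hYt
            have := hcw.eventually_lt hlin (by
              beta_reduce; rw [sub_self, mul_zero, sub_zero, hU, max_eq_left h.le]; exact h)
            filter_upwards [this] with s hs using hs.le
          · have hd := hdz (Y t) (hL1.trans_le hLt) hMt' h
            have hb : c2 ≤ lamz (Y t).2 := hc2' (Y t) ⟨⟨hLt, hMt'⟩, h⟩
            have h1 := aux_traj (a := -c) hWL ht hZ hd (by linarith)
            rw [hU (Y t), max_eq_right h]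
            filter_upwards [h1] with s hs
            linarith
        filter_upwards [e1, e2] with s h1 h2
        rw [hU (Y s)]
        exact max_le h1 h2)
      filter_upwards [eventually_ge_atTop 0, eventually_ge_atTop ((Mh - L) / c)] with t h0 h1
      rw [div_le_iff₀ hcpos] at h1
      refine (hcmp t h0).trans (max_le le_rfl ?_)
      linarith
    refine le_of_forall_gt_imp_ge_of_dense ?_
    intro r hr
    obtain ⟨L, hL1, hL2⟩ := EReal.lt_iff_exists_real_btwn.1 hr
    have hL1' : Mt < L := by exact_mod_cast hL1
    have := main (min L Mh) (lt_min hL1' hMM) (min_le_right _ _)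
    refine le_trans (Filter.limsup_le_of_le (h := ?_)) hL2.le
    filter_upwards [this] with t ht
    exact_mod_cast ht.trans (min_le_left _ _)
end
end

section
/- Corollary 1 (local stabilization). Let V be a storage function on ℝ^n and W a storage function on ℝ^m, let f ∈ C¹(ℝ^n × ℝ^m, ℝ^n), g ∈ C¹(ℝ^n × ℝ^m, ℝ^m), and suppose Assumption 1 holds with M̲ = N̲ = 0 and constants M̄, N̄ ∈ (0,∞] not both infinite (with the conventions that a constraint of the form V(x) ≤ ∞ or W(z) ≤ ∞ is vacuous, δ(∞) := ∞, and min{a,∞} := a), together with class K∞ gains γ, δ and continuous positive definite proper λ_x, λ_z, and suppose γ(δ(s)) < s for every s ∈ (0, M̄] if M̄ < ∞ (for every s ∈ (0,∞) if M̄ = ∞). Then there exists a continuous, proper, positive definite function U : ℝ^n × ℝ^m → [0,∞), locally Lipschitz on (ℝ^n × ℝ^m) \ {(0,0)}, such that, setting M̂ℓ := min{δ(M̄), N̄}, the sublevel set Ω_{≤M̂ℓ}(U) is contained in the basin of attraction of the origin: every forward-complete solution Y of the interconnected system with U(Y(0)) ≤ M̂ℓ satisfies U(Y(t)) ≤ M̂ℓ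 for all t ≥ 0 and Y(t) → 0 as t → ∞. -/
open Filter Topology Set

noncomputable section

lemma sigma_exists (γ δ : ℝ → ℝ) (hγ : ClassKInf γ) (hδ : ClassKInf δ) (Mu : WithTop ℝ)
    (hA2 : ∀ s : ℝ, 0 < s → (s : WithTop ℝ) ≤ Mu → γ (δ s) < s) :
    ∃ σ : ℝ → ℝ, Continuous σ ∧ σ 0 = 0 ∧ StrictMonoOn σ (Set.Ici 0) ∧
      (∀ s, 0 < s → δ s < σ s) ∧
      (∀ s : ℝ, 0 < s → (s : WithTop ℝ) ≤ Mu → γ (σ s) < s) ∧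
      (∀ s, 0 < s → ∃ K : NNReal, ∃ t ∈ 𝓝 s, LipschitzOnWith K σ t) := by
  obtain ⟨hγc, hγm, hγ0, -⟩ := hγ
  obtain ⟨hδc, hδm, hδ0, -⟩ := hδ
  set D : ℝ → ℝ := fun s => δ (max s 0) with hD
  have hDc : Continuous D :=
    hδc.comp_continuous (by fun_prop) (fun s => mem_Ici.2 (le_max_right _ _))
  have hDmono : Monotone D := fun s t hst =>
    hδm.monotoneOn (mem_Ici.2 (le_max_right _ _)) (mem_Ici.2 (le_max_right _ _)) (max_le_max hst le_rfl)
  have hDpos : ∀ s, 0 ≤ s → D s = δ s := fun s hs => by simp [hD, max_eq_left hs]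
  have hDlt : ∀ s t, 0 ≤ s → s < t → D s < D t := fun s t hs hst => by
    rw [hDpos s hs, hDpos t (hs.trans hst.le)]; exact hδm hs (hs.trans hst.le) hst
  have hD0 : ∀ s, 0 ≤ D s := fun s => by
    have := hδm.monotoneOn (a := 0) (b := max s 0) (by simp) (by simp) (le_max_right _ _)
    rw [hδ0] at this; exact this
  have hGc : Continuous (fun t => γ (D t)) := hγc.comp_continuous hDc hD0
  set A : Set (ℝ × ℝ) := {p | p.1 ≤ 0} ∪ ({p | (p.1 : WithTop ℝ) ≤ Mu} ∩ {p | p.1 ≤ γ (D p.2)}) with hA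
  have hAc : IsClosed A := by
    refine IsClosed.union (isClosed_le continuous_fst continuous_const) (IsClosed.inter ?_
      (isClosed_le continuous_fst (hGc.comp continuous_snd)))
    induction Mu using WithTop.recTopCoe with
    | top => simp
    | coe M => simpa using isClosed_le (continuous_fst : Continuous (Prod.fst : ℝ × ℝ → ℝ)) continuous_const
  have hAn : A.Nonempty := ⟨(0, 0), Or.inl (by simp)⟩
  set θ : ℝ → ℝ := fun s => Metric.infDist ((s, s) : ℝ × ℝ) A / 2 with hθ
  have hθL : ∀ s t, |θ s - θ t| ≤ |s - t| / 2 := by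
    intro s t
    have h := (Metric.lipschitz_infDist_pt A).dist_le_mul (s, s) (t, t)
    simp only [NNReal.coe_one, one_mul, Real.dist_eq, Prod.dist_eq, max_self] at h
    have : θ s - θ t = (Metric.infDist ((s, s) : ℝ × ℝ) A - Metric.infDist ((t, t) : ℝ × ℝ) A) / 2 := by
      simp only [hθ]; ring
    rw [this, abs_div, abs_two]; linarith
  have hθ1 : LipschitzWith 1 θ := LipschitzWith.of_dist_le_mul fun s t => by
    have := hθL s t; have h2 := abs_nonneg (s - t)
    simp only [Real.dist_eq, NNReal.coe_one]; linarith
  have hθc : Continuous θ := hθ1.continuous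
  have hθn : ∀ s, 0 ≤ θ s := fun s => div_nonneg Metric.infDist_nonneg (by norm_num)
  have hθpos : ∀ s, 0 < s → 0 < θ s := by
    intro s hs
    have : ((s, s) : ℝ × ℝ) ∉ A := by
      rintro (h | ⟨h1, h2⟩)
      · exact absurd h (not_le.2 hs)
      · have := hA2 s hs h1
        simp only [mem_ofPred_eq, hDpos s hs.le] at h2
        linarith
    exact half_pos ((hAc.notMem_iff_infDist_pos hAn).1 this)
  have hθ0 : θ 0 = 0 := by
    have : ((0, 0) : ℝ × ℝ) ∈ A := Or.inl (by simp)
    simp [hθ, Metric.infDist_zero_of_mem this]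
  have hθA : ∀ s : ℝ, 0 < s → (s : WithTop ℝ) ≤ Mu → γ (D (s + θ s)) < s := by
    intro s hs hM
    by_contra! hcon
    have hmem : ((s, s + θ s) : ℝ × ℝ) ∈ A := Or.inr ⟨hM, hcon⟩
    have h := Metric.infDist_le_dist_of_mem (x := ((s, s) : ℝ × ℝ)) hmem
    have h2 := hθpos s hs
    simp only [Prod.dist_eq, dist_self, Real.dist_eq] at h
    have h3 : |s - (s + θ s)| = θ s := by
      rw [show s - (s + θ s) = -θ s by ring, abs_neg, abs_of_pos h2]
    rw [h3, max_eq_right h2.le] at h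
    have : θ s = Metric.infDist ((s, s) : ℝ × ℝ) A / 2 := rfl
    linarith
  have hmon : ∀ s t u, s < t → 0 ≤ u → u ≤ 1 → s + θ s * u < t + θ t * u := by
    intro s t u hst hu hu1
    have h := hθL s t
    rw [abs_of_neg (by linarith : s - t < 0)] at h
    have h2 := (abs_le.1 h).2
    nlinarith
  have hic : ∀ s, Continuous (fun u => D (s + θ s * u)) := fun s => hDc.comp (by fun_prop)
  refine ⟨fun s => ∫ u in (0:ℝ)..1, D (s + θ s * u), ?_, ?_, ?_, ?_, ?_, ?_⟩
  · apply intervalIntegral.continuous_parametric_intervalIntegral_of_continuous'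
    exact hDc.comp (by fun_prop)
  · simp [hθ0, hD, hδ0]
  · intro s hs t ht hst
    have hs : 0 ≤ s := hs
    apply intervalIntegral.integral_lt_integral_of_continuousOn_of_le_of_exists_lt (by norm_num)
      (hic s).continuousOn (hic t).continuousOn
    · intro u hu
      exact hDmono (hmon s t u hst hu.1.le hu.2).le
    · exact ⟨0, by simp, by simpa using hDlt s t hs hst⟩
  · intro s hs
    have : δ s = ∫ u in (0:ℝ)..1, D s := by simp [hDpos s hs.le]
    rw [this]
    apply intervalIntegral.integral_lt_integral_of_continuousOn_of_le_of_exists_lt (by norm_num)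
      continuousOn_const (hic s).continuousOn
    · intro u hu
      have := mul_nonneg (hθn s) hu.1.le
      exact hDmono (by linarith)
    · exact ⟨1, by simp, by simpa using hDlt s _ hs.le (by simpa using hθpos s hs)⟩
  · intro s hs hM
    refine lt_of_le_of_lt (hγm.monotoneOn ?_ (hD0 _) ?_) (hθA s hs hM)
    · exact intervalIntegral.integral_nonneg (by norm_num) fun u _ => hD0 _
    · have : D (s + θ s) = ∫ u in (0:ℝ)..1, D (s + θ s) := by simp
      rw [this]
      apply intervalIntegral.integral_mono_on (by norm_num) ((hic s).intervalIntegrable _ _)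
        (continuous_const.intervalIntegrable _ _)
      intro u hu
      have := mul_le_mul_of_nonneg_left hu.2 (hθn s)
      exact hDmono (by linarith)
  · intro s hs
    set P : ℝ → ℝ := fun x => ∫ y in (0:ℝ)..x, D y with hP
    have hPd : ∀ x, HasDerivAt P (D x) x := fun x =>
      intervalIntegral.integral_hasDerivAt_right (hDc.intervalIntegrable _ _)
        hDc.aestronglyMeasurable.stronglyMeasurableAtFilter hDc.continuousAt
    have hPC : ContDiff ℝ 1 P := by
      rw [contDiff_one_iff_deriv]
      refine ⟨fun x => (hPd x).differentiableAt, ?_⟩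
      rw [show deriv P = D from funext fun x => (hPd x).deriv]; exact hDc
    have hG : ContDiffAt ℝ 1 (fun p : ℝ × ℝ => (p.2)⁻¹ * (P (p.1 + p.2) - P p.1)) (s, θ s) := by
      have h1 : ContDiffAt ℝ 1 (fun p : ℝ × ℝ => (p.2)⁻¹) (s, θ s) :=
        contDiffAt_snd.inv (hθpos s hs).ne'
      exact h1.mul (((hPC.comp (contDiff_fst.add contDiff_snd)).sub (hPC.comp contDiff_fst)).contDiffAt)
    obtain ⟨K, t, ht, hK⟩ := hG.exists_lipschitzOnWith
    have hcont : Continuous (fun r : ℝ => (r, θ r)) := by fun_prop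
    have hl : LipschitzWith 1 (fun r : ℝ => (r, θ r)) := by
      simpa using LipschitzWith.id.prodMk hθ1
    refine ⟨K * 1, (fun r : ℝ => (r, θ r)) ⁻¹' t ∩ Ioi 0, inter_mem (hcont.continuousAt ht) (Ioi_mem_nhds hs), ?_⟩
    have h2 := (hK.comp (hl.lipschitzOnWith (s := (fun r : ℝ => (r, θ r)) ⁻¹' t)) (fun x hx => hx)).mono
      (inter_subset_left : (fun r : ℝ => (r, θ r)) ⁻¹' t ∩ Ioi 0 ⊆ _)
    have heq : ∀ r ∈ (fun r : ℝ => (r, θ r)) ⁻¹' t ∩ Ioi 0, (∫ u in (0:ℝ)..1, D (r + θ r * u)) =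
        ((fun p : ℝ × ℝ => (p.2)⁻¹ * (P (p.1 + p.2) - P p.1)) ∘ (fun r : ℝ => (r, θ r))) r := ?_
    · intro p hp q hq
      have := h2 hp hq
      rw [← heq p hp, ← heq q hq] at this
      exact this
    intro r hr
    have hr0 := hθpos r hr.2
    simp only [Function.comp]
    rw [intervalIntegral.integral_comp_add_mul D hr0.ne' r]
    simp only [mul_zero, add_zero, mul_one, smul_eq_mul, hP]
    rw [intervalIntegral.integral_interval_sub_left (hDc.intervalIntegrable _ _) (hDc.intervalIntegrable _ _)]

lemma posdef_lower {E : Type*} [NormedAddCommGroup E] [ProperSpace E] (lam : E → ℝ)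
    (hc : Continuous lam) (hp : PosDefFun lam) (hpr : ProperFun lam) (S : Set E)
    (hS : IsClosed S) (h0 : (0 : E) ∉ S) : ∃ l : ℝ, 0 < l ∧ ∀ x ∈ S, l ≤ lam x := by
  obtain ⟨R, hR⟩ := hpr 1
  have hcomp : IsCompact (Metric.closedBall (0:E) R ∩ S) := (isCompact_closedBall 0 R).inter_right hS
  rcases (Metric.closedBall (0:E) R ∩ S).eq_empty_or_nonempty with he | hne
  · refine ⟨1, one_pos, fun x hx => hR x ?_⟩
    by_contra! h
    have : x ∈ Metric.closedBall (0:E) R ∩ S := ⟨by simpa using h.le, hx⟩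
    rw [he] at this; exact this
  · obtain ⟨y, hy, hmin⟩ := hcomp.exists_isMinOn hne hc.continuousOn
    have hy0 : 0 < lam y := hp.2 y (fun h => h0 (h ▸ hy.2))
    refine ⟨min 1 (lam y), lt_min one_pos hy0, fun x hx => ?_⟩
    rcases le_total R ‖x‖ with h | h
    · exact (min_le_left _ _).trans (hR x h)
    · exact (min_le_right _ _).trans (hmin ⟨by simpa using h, hx⟩)

lemma slope_of_dini {E : Type*} [NormedAddCommGroup E] [NormedSpace ℝ E] (V : E → ℝ)
    (hV : LocallyLipschitz V) (X : ℝ → E) (d : E) (t l k : ℝ) (ht : 0 ≤ t)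
    (hX : HasDerivWithinAt X d (Set.Ici 0) t)
    (hd : dini V d (X t) ≤ ((-l : ℝ) : EReal)) (hk : k < l) :
    ∀ᶠ z in 𝓝[>] t, V (X z) ≤ V (X t) - k * (z - t) := by
  obtain ⟨k', hk1, hk2⟩ := exists_between hk
  have hX' : HasDerivWithinAt X d (Set.Ioi t) t :=
    hX.mono (fun z hz => ht.trans (le_of_lt hz))
  have h1 : ∀ᶠ τ in 𝓝[>] (0:ℝ), (((V (X t + τ • d) - V (X t)) / τ : ℝ) : EReal) < ((-k' : ℝ) : EReal) := by
    exact Filter.eventually_lt_of_limsup_lt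
      (lt_of_le_of_lt hd (by exact_mod_cast neg_lt_neg hk2))
  have hshift : Tendsto (fun z => z - t) (𝓝[>] t) (𝓝[>] (0:ℝ)) := by
    apply tendsto_nhdsWithin_of_tendsto_nhds_of_eventually_within
    · have : Continuous (fun z : ℝ => z - t) := by fun_prop
      simpa using (this.tendsto t).mono_left nhdsWithin_le_nhds
    · filter_upwards [self_mem_nhdsWithin] with z hz
      simpa using hz
  have h2 := hshift.eventually h1
  obtain ⟨K, s, hs, hK⟩ := hV (X t)
  have h3 : ∀ᶠ z in 𝓝[>] t, X z ∈ s := hX'.continuousWithinAt hs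
  have hlin : Tendsto (fun z => X t + (z - t) • d) (𝓝[>] t) (𝓝 (X t)) := by
    have : Continuous (fun z : ℝ => X t + (z - t) • d) := by fun_prop
    simpa using (this.tendsto t).mono_left nhdsWithin_le_nhds
  have h4 : ∀ᶠ z in 𝓝[>] t, X t + (z - t) • d ∈ s := hlin hs
  have hε : 0 < (k' - k) / (K + 1) := div_pos (by linarith) (by positivity)
  have h5 := (hasDerivWithinAt_iff_isLittleO.1 hX').def hε
  filter_upwards [h2, h3, h4, h5, self_mem_nhdsWithin] with z h2 h3 h4 h5 hz
  have hz : 0 < z - t := sub_pos.2 hz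
  have h2 : (V (X t + (z - t) • d) - V (X t)) / (z - t) < -k' := by exact_mod_cast h2
  rw [div_lt_iff₀ hz] at h2
  have h6 := hK.dist_le_mul _ h3 _ h4
  rw [Real.dist_eq, dist_eq_norm, show X z - (X t + (z - t) • d) = X z - X t - (z - t) • d by abel] at h6
  rw [Real.norm_of_nonneg hz.le] at h5
  have h7 := (abs_le.1 h6).2
  have h8 : (K:ℝ) * ‖X z - X t - (z - t) • d‖ ≤ (k' - k) * (z - t) := by
    calc (K:ℝ) * ‖X z - X t - (z - t) • d‖ ≤ (K + 1) * ((k' - k) / (K + 1) * (z - t)) := by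
          gcongr; linarith
      _ = (k' - k) * (z - t) := by field_simp
  nlinarith

lemma abstract_conv (v w : ℝ → ℝ) (hvc : ContinuousOn v (Ici 0)) (hwc : ContinuousOn w (Ici 0))
    (hv0 : ∀ t, 0 ≤ v t) (hw0 : ∀ t, 0 ≤ w t) (γ δ σ : ℝ → ℝ)
    (hγ : ClassKInf γ) (hδ : ClassKInf δ) (Mu Nu : WithTop ℝ)
    (hσc : Continuous σ) (hσ0 : σ 0 = 0) (hσm : StrictMonoOn σ (Ici 0))
    (hσδ : ∀ s, 0 < s → δ s < σ s)
    (hσγ : ∀ s : ℝ, 0 < s → (s : WithTop ℝ) ≤ Mu → γ (σ s) < s)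
    (M : ℝ) (hM1 : ∀ s : ℝ, 0 ≤ s → σ s ≤ M → (s : WithTop ℝ) ≤ Mu)
    (hM2 : (M : WithTop ℝ) ≤ Nu) (hM : 0 < M)
    (hv : ∀ a : ℝ, 0 < a → ∃ l : ℝ, 0 < l ∧ ∀ t : ℝ, 0 ≤ t → (v t : WithTop ℝ) ≤ Mu →
      (w t : WithTop ℝ) ≤ Nu → γ (w t) ≤ v t → a ≤ v t →
      ∀ᶠ z in 𝓝[>] t, v z ≤ v t - l * (z - t))
    (hw : ∀ a : ℝ, 0 < a → ∃ l : ℝ, 0 < l ∧ ∀ t : ℝ, 0 ≤ t → (v t : WithTop ℝ) ≤ Mu →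
      (w t : WithTop ℝ) ≤ Nu → δ (v t) ≤ w t → a ≤ w t →
      ∀ᶠ z in 𝓝[>] t, w z ≤ w t - l * (z - t))
    (h0 : max (σ (v 0)) (w 0) ≤ M) :
    (∀ t, 0 ≤ t → max (σ (v t)) (w t) ≤ M) ∧
    ∀ ε : ℝ, 0 < ε → ∃ T, ∀ t, T ≤ t → max (σ (v t)) (w t) ≤ ε := by
  obtain ⟨hγc, hγm, hγ0, -⟩ := hγ
  obtain ⟨hδc, hδm, hδ0, hδt⟩ := hδ
  have hσn : ∀ s, 0 ≤ s → 0 ≤ σ s := fun s hs => by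
    have := hσm.monotoneOn (a := 0) (b := s) (by simp) hs hs; rwa [hσ0] at this
  have hsvc : ContinuousOn (fun t => σ (v t)) (Ici 0) := hσc.comp_continuousOn hvc
  have hcv : ∀ t, 0 ≤ t → Tendsto v (𝓝[>] t) (𝓝 (v t)) := fun t ht =>
    ((hvc t ht).mono (fun z hz => ht.trans (le_of_lt hz)))
  have hcw : ∀ t, 0 ≤ t → Tendsto w (𝓝[>] t) (𝓝 (w t)) := fun t ht =>
    ((hwc t ht).mono (fun z hz => ht.trans (le_of_lt hz)))
  -- invariance of each positive level
  have inv : ∀ c, 0 < c → c ≤ M → ∀ t0, 0 ≤ t0 → max (σ (v t0)) (w t0) ≤ c →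
      ∀ t, t0 ≤ t → max (σ (v t)) (w t) ≤ c := by
    intro c hc hcM t0 ht0 hu t ht
    have hsub : Icc t0 t ⊆ {t | max (σ (v t)) (w t) ≤ c} := by
      apply IsClosed.Icc_subset_of_forall_mem_nhdsWithin
      · have h1 : ContinuousOn (fun t => max (σ (v t)) (w t)) (Icc t0 t) :=
          (hsvc.sup hwc).mono (fun z hz => ht0.trans hz.1)
        rw [inter_comm]
        exact h1.preimage_isClosed_of_isClosed isClosed_Icc isClosed_Iic
      · exact hu
      · rintro s ⟨hs, hst⟩
        have hs0 : 0 ≤ s := ht0.trans hst.1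
        have hsσ : σ (v s) ≤ c := (le_max_left _ _).trans hs
        have hsw : w s ≤ c := (le_max_right _ _).trans hs
        have hVM := hM1 _ (hv0 s) (hsσ.trans hcM)
        have hWN : (w s : WithTop ℝ) ≤ Nu :=
          le_trans (by exact_mod_cast hsw.trans hcM) hM2
        have e1 : ∀ᶠ z in 𝓝[>] s, σ (v z) ≤ c := by
          rcases hsσ.lt_or_eq with h | h
          · have := ((hσc.tendsto (v s)).comp (hcv s hs0)).eventually (gt_mem_nhds h)
            exact this.mono fun z hz => le_of_lt hz
          · have hvpos : 0 < v s := by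
              refine lt_of_le_of_ne (hv0 s) fun h' => ?_
              rw [← h', hσ0] at h; linarith
            obtain ⟨l, hl, hl2⟩ := hv (v s) hvpos
            have hg : γ (w s) ≤ v s :=
              (hγm.monotoneOn (hw0 s) (hσn _ (hv0 s)) (hsw.trans h.ge)).trans
                (hσγ _ hvpos hVM).le
            filter_upwards [hl2 s hs0 hVM hWN hg le_rfl, self_mem_nhdsWithin] with z hz hzs
            have : 0 < l * (z - s) := mul_pos hl (sub_pos.2 hzs)
            exact (hσm.monotoneOn (hv0 z) (hv0 s) (by linarith)).trans h.le
        have e2 : ∀ᶠ z in 𝓝[>] s, w z ≤ c := by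
          rcases hsw.lt_or_eq with h | h
          · exact ((hcw s hs0).eventually (gt_mem_nhds h)).mono fun z hz => le_of_lt hz
          · obtain ⟨l, hl, hl2⟩ := hw (w s) (by linarith)
            have hg : δ (v s) ≤ w s := by
              rcases (hv0 s).lt_or_eq with h' | h'
              · exact (hσδ _ h').le.trans (by linarith)
              · rw [← h', hδ0]; exact hw0 s
            filter_upwards [hl2 s hs0 hVM hWN hg le_rfl, self_mem_nhdsWithin] with z hz hzs
            have : 0 < l * (z - s) := mul_pos hl (sub_pos.2 hzs)
            linarith
        filter_upwards [e1, e2] with z h1 h2 using max_le h1 h2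
    exact hsub ⟨ht, le_rfl⟩
  refine ⟨inv M hM le_rfl 0 le_rfl h0, fun ε hε => ?_⟩
  by_contra! hcon
  have hge : ∀ t, 0 ≤ t → min ε M ≤ max (σ (v t)) (w t) := by
    intro t ht
    by_contra! h
    obtain ⟨s, hs, hs2⟩ := hcon t
    have := inv (min ε M) (lt_min hε hM) (min_le_right _ _) t ht h.le s hs
    exact absurd (this.trans (min_le_left _ _)) (not_le.2 hs2)
  set I : Set ℝ := (fun t => max (σ (v t)) (w t)) '' Ici 0 with hI
  have hIn : I.Nonempty := ⟨_, 0, by simp, rfl⟩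
  have hIb : BddBelow I := ⟨min ε M, by rintro _ ⟨t, ht, rfl⟩; exact hge t ht⟩
  set c := sInf I with hc
  have hcpos : 0 < c := lt_of_lt_of_le (lt_min hε hM)
    (le_csInf hIn (by rintro _ ⟨t, ht, rfl⟩; exact hge t ht))
  have hcle : ∀ t, 0 ≤ t → c ≤ max (σ (v t)) (w t) := fun t ht => csInf_le hIb ⟨t, ht, rfl⟩
  have hcM : c ≤ M := (hcle 0 le_rfl).trans h0
  -- a with σ a = c
  obtain ⟨a, ha0, hac⟩ : ∃ a, 0 ≤ a ∧ σ a = c := by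
    obtain ⟨B, hB1, hB2⟩ := ((hδt.eventually_ge_atTop c).and (eventually_gt_atTop 0)).exists
    have := intermediate_value_Icc hB2.le hσc.continuousOn
    obtain ⟨a, ha, h⟩ := this (show c ∈ Icc (σ 0) (σ B) from
      ⟨by rw [hσ0]; exact hcpos.le, hB1.trans (hσδ B hB2).le⟩)
    exact ⟨a, ha.1, h⟩
  have ha : 0 < a := by
    refine lt_of_le_of_ne ha0 fun h => ?_
    rw [← h, hσ0] at hac; linarith
  have haM : (a : WithTop ℝ) ≤ Mu := hM1 a ha0 (hac.le.trans hcM)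
  have g1 : γ (σ a) < a := hσγ a ha haM
  have g2 : δ a < σ a := hσδ a ha
  have hγat : ContinuousAt γ (σ a) := hγc.continuousAt (Ici_mem_nhds (by linarith))
  have hδat : ContinuousAt δ a := hδc.continuousAt (Ici_mem_nhds ha)
  obtain ⟨b, ⟨hb1, hb2⟩, hab⟩ : ∃ b, (γ (σ b) < a ∧ δ b < σ a) ∧ a < b := by
    have e1 : ∀ᶠ b in 𝓝 a, γ (σ b) < a :=
      (ContinuousAt.comp (f := σ) (g := γ) hγat hσc.continuousAt).eventually (gt_mem_nhds g1)
    have e2 : ∀ᶠ b in 𝓝 a, δ b < σ a := hδat.eventually (gt_mem_nhds g2)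
    exact (((e1.and e2).filter_mono nhdsWithin_le_nhds).and
      (self_mem_nhdsWithin : Ioi a ∈ 𝓝[>] a)).exists
  obtain ⟨a', ⟨⟨ha1, ha2⟩, ha3⟩, haa⟩ : ∃ a', ((γ (σ b) < a' ∧ δ b < σ a') ∧ 0 < a') ∧ a' < a := by
    have e1 : ∀ᶠ x in 𝓝 a, γ (σ b) < x := lt_mem_nhds hb1
    have e2 : ∀ᶠ x in 𝓝 a, δ b < σ x := (hσc.tendsto a).eventually (lt_mem_nhds hb2)
    exact ((((e1.and e2).and (lt_mem_nhds ha)).filter_mono nhdsWithin_le_nhds).and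
      (self_mem_nhdsWithin : Iio a ∈ 𝓝[<] a)).exists
  have hb0 : 0 ≤ b := by linarith
  have hσa' : 0 < σ a' := by have := hσm (a := 0) (b := a') (by simp) ha3.le ha3; rwa [hσ0] at this
  have hσab : c < σ b := by rw [← hac]; exact hσm ha0 hb0 hab
  have hσaa : σ a' < c := by rw [← hac]; exact hσm ha3.le ha0 haa
  -- a time after which everything is at most σ b
  obtain ⟨_, ⟨T, hT, rfl⟩, hTlt⟩ := exists_lt_of_csInf_lt hIn hσab
  have hT : 0 ≤ T := hT
  have hTM := inv M hM le_rfl 0 le_rfl h0 T hT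
  have hTall := inv _ (lt_of_lt_of_le hcpos (hcle T hT)) hTM T hT le_rfl
  obtain ⟨l1, hl1, hl1'⟩ := hv a' ha3
  obtain ⟨l2, hl2, hl2'⟩ := hw (σ a') hσa'
  set k := min l1 l2 with hk
  have hkpos : 0 < k := lt_min hl1 hl2
  set C := max (max (v T - a') (w T - σ a')) 0 with hC
  have hC0 : 0 ≤ C := le_max_right _ _
  set T1 := T + C / k with hT1
  have hTT1 : T ≤ T1 := by have := div_nonneg hC0 hkpos.le; linarith
  have hsub : Icc T T1 ⊆ {t | max (v t - a') (w t - σ a') ≤ C - k * (t - T)} := by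
    apply IsClosed.Icc_subset_of_forall_mem_nhdsWithin
    · have hs : Icc T T1 ⊆ Ici 0 := fun z hz => hT.trans hz.1
      have h1 : ContinuousOn (fun t => max (v t - a') (w t - σ a') - (C - k * (t - T))) (Icc T T1) :=
        ContinuousOn.sub (((hvc.mono hs).sub continuousOn_const).sup
          ((hwc.mono hs).sub continuousOn_const)) (by fun_prop)
      have := h1.preimage_isClosed_of_isClosed isClosed_Icc (isClosed_Iic (a := (0:ℝ)))
      convert this using 1
      ext z
      simp [and_comm]
    · have : max (v T - a') (w T - σ a') ≤ C := le_max_left _ _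
      simpa only [mem_ofPred_eq, sub_self, mul_zero, sub_zero] using this
    · rintro s ⟨hs, hst⟩
      have hs0 : 0 ≤ s := hT.trans hst.1
      have hs1 : v s - a' ≤ C - k * (s - T) := (le_max_left _ _).trans hs
      have hs2 : w s - σ a' ≤ C - k * (s - T) := (le_max_right _ _).trans hs
      have hus := hTall s hst.1
      have husb : max (σ (v s)) (w s) ≤ σ b := hus.trans hTlt.le
      have husM := hus.trans hTM
      have hVM := hM1 _ (hv0 s) ((le_max_left _ _).trans husM)
      have hWN : (w s : WithTop ℝ) ≤ Nu :=
        le_trans (by exact_mod_cast (le_max_right _ _).trans husM) hM2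
      have hvb : v s ≤ b := (hσm.le_iff_le (hv0 s) hb0).1 ((le_max_left _ _).trans husb)
      have hwb : w s ≤ σ b := (le_max_right _ _).trans husb
      have hsmall : ∀ᶠ z in 𝓝[>] s, 0 ≤ C - k * (z - T) := by
        have : ∀ᶠ z in 𝓝[>] s, z < T1 := (gt_mem_nhds hst.2).filter_mono nhdsWithin_le_nhds
        filter_upwards [this] with z hz
        have h1 : z - T < C / k := by linarith
        rw [lt_div_iff₀ hkpos] at h1
        linarith
      have e1 : ∀ᶠ z in 𝓝[>] s, v z - a' ≤ C - k * (z - T) := by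
        rcases lt_or_ge (v s) a' with h | h
        · filter_upwards [hsmall, (hcv s hs0).eventually (gt_mem_nhds h)] with z h1 h2
          linarith
        · have hg : γ (w s) ≤ v s :=
            (hγm.monotoneOn (hw0 s) (hσn _ hb0) hwb).trans (ha1.le.trans h)
          filter_upwards [hl1' s hs0 hVM hWN hg h, self_mem_nhdsWithin] with z hz hzs
          have h3 : 0 < z - s := sub_pos.2 hzs
          have := mul_le_mul_of_nonneg_right (min_le_left l1 l2) h3.le
          have h4 : k * (z - T) = k * (z - s) + k * (s - T) := by ring
          linarith
      have e2 : ∀ᶠ z in 𝓝[>] s, w z - σ a' ≤ C - k * (z - T) := by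
        rcases lt_or_ge (w s) (σ a') with h | h
        · filter_upwards [hsmall, (hcw s hs0).eventually (gt_mem_nhds h)] with z h1 h2
          linarith
        · have hg : δ (v s) ≤ w s :=
            (hδm.monotoneOn (hv0 s) hb0 hvb).trans (ha2.le.trans h)
          filter_upwards [hl2' s hs0 hVM hWN hg h, self_mem_nhdsWithin] with z hz hzs
          have h3 : 0 < z - s := sub_pos.2 hzs
          have := mul_le_mul_of_nonneg_right (min_le_right l1 l2) h3.le
          have h4 : k * (z - T) = k * (z - s) + k * (s - T) := by ring
          linarith
      filter_upwards [e1, e2] with z h1 h2 using max_le h1 h2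
  have hfin : max (v T1 - a') (w T1 - σ a') ≤ C - k * (T1 - T) := hsub ⟨hTT1, le_rfl⟩
  have hz : C - k * (T1 - T) = 0 := by rw [hT1]; field_simp; ring
  rw [hz] at hfin
  have f1 : v T1 ≤ a' := by have := (le_max_left _ _).trans hfin; linarith
  have f2 : w T1 ≤ σ a' := by have := (le_max_right _ _).trans hfin; linarith
  have f3 := max_le (hσm.monotoneOn (hv0 T1) ha3.le f1) f2
  have := hcle T1 (hT.trans hTT1)
  linarith

lemma IsStorage.zero {E : Type*} [NormedAddCommGroup E] {V : E → ℝ} (h : IsStorage V) : V 0 = 0 := by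
  obtain ⟨h0, -, a, b, ha, hb, hab⟩ := h
  have := (hab 0).2
  rw [norm_zero, hb.2.2.1] at this
  exact le_antisymm this (h0 0)

lemma IsStorage.pos {E : Type*} [NormedAddCommGroup E] {V : E → ℝ} (h : IsStorage V) {x : E}
    (hx : x ≠ 0) : 0 < V x := by
  obtain ⟨h0, -, a, b, ha, hb, hab⟩ := h
  refine lt_of_lt_of_le ?_ (hab x).1
  have := ha.2.1 (show (0:ℝ) ∈ Ici 0 by simp) (show ‖x‖ ∈ Ici 0 from norm_nonneg x) (norm_pos_iff.2 hx)
  rwa [ha.2.2.1] at this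

lemma IsStorage.proper {E : Type*} [NormedAddCommGroup E] {V : E → ℝ} (h : IsStorage V) :
    ProperFun V := by
  obtain ⟨h0, -, a, b, ha, hb, hab⟩ := h
  intro C
  obtain ⟨R, hR⟩ := (ha.2.2.2.eventually_ge_atTop C).exists_forall_of_atTop
  exact ⟨R, fun y hy => (hR _ hy).trans (hab y).1⟩

lemma exists_level (δ σ : ℝ → ℝ) (hδ : ClassKInf δ) (Mu Nu : WithTop ℝ) (hMu : 0 < Mu)
    (hNu : 0 < Nu) (hnotboth : ¬(Mu = ⊤ ∧ Nu = ⊤)) (hσm : StrictMonoOn σ (Ici 0))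
    (hσδ : ∀ s, 0 < s → δ s < σ s) :
    ∃ M : ℝ, min (WithTop.map δ Mu) Nu = (M : WithTop ℝ) ∧ 0 < M ∧ (M : WithTop ℝ) ≤ Nu ∧
      ∀ s : ℝ, 0 ≤ s → σ s ≤ M → (s : WithTop ℝ) ≤ Mu := by
  have key : ∀ m : ℝ, 0 < m → 0 < δ m ∧ ∀ s, 0 ≤ s → σ s ≤ δ m → s ≤ m := by
    intro m hm
    have h1 := hδ.2.1 (show (0:ℝ) ∈ Ici 0 by simp) (show m ∈ Ici 0 from hm.le) hm
    rw [hδ.2.2.1] at h1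
    exact ⟨h1, fun s hs h => (hσm.le_iff_le hs hm.le).1 (h.trans (hσδ m hm).le)⟩
  induction Mu using WithTop.recTopCoe with
  | top =>
    induction Nu using WithTop.recTopCoe with
    | top => exact absurd ⟨rfl, rfl⟩ hnotboth
    | coe N => exact ⟨N, by simp, by exact_mod_cast hNu, le_rfl, fun s _ _ => le_top⟩
  | coe m =>
    have hm : 0 < m := by exact_mod_cast hMu
    obtain ⟨k1, k2⟩ := key m hm
    induction Nu using WithTop.recTopCoe with
    | top => exact ⟨δ m, by simp, k1, le_top, fun s hs h => by exact_mod_cast k2 s hs h⟩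
    | coe N =>
      refine ⟨min (δ m) N, by simp, lt_min k1 (by exact_mod_cast hNu),
        by exact_mod_cast min_le_right _ _, fun s hs h => ?_⟩
      exact_mod_cast k2 s hs (h.trans (min_le_left _ _))

/-- **Corollary 1** (local stabilization). Here `M̄`, `N̄` live in `WithTop ℝ = (−∞,∞]`;
a constraint against `⊤` is automatically vacuous, `WithTop.map δ` implements the
convention `δ(∞) = ∞`, and `min` on `WithTop ℝ` implements `min {a, ∞} = a`. -/
theorem corollary1_local_stabilization
    (n m : ℕ) (hn : 1 ≤ n) (hm : 1 ≤ m)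
    (V : EuclideanSpace ℝ (Fin n) → ℝ) (W : EuclideanSpace ℝ (Fin m) → ℝ)
    (hV : IsStorage V) (hW : IsStorage W)
    (f : EuclideanSpace ℝ (Fin n) × EuclideanSpace ℝ (Fin m) → EuclideanSpace ℝ (Fin n))
    (g : EuclideanSpace ℝ (Fin n) × EuclideanSpace ℝ (Fin m) → EuclideanSpace ℝ (Fin m))
    (hf : ContDiff ℝ 1 f) (hg : ContDiff ℝ 1 g)
    (γ δ : ℝ → ℝ) (hγ : ClassKInf γ) (hδ : ClassKInf δ)
    (lamx : EuclideanSpace ℝ (Fin n) → ℝ) (lamz : EuclideanSpace ℝ (Fin m) → ℝ)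
    (hlamx : Continuous lamx ∧ PosDefFun lamx ∧ ProperFun lamx)
    (hlamz : Continuous lamz ∧ PosDefFun lamz ∧ ProperFun lamz)
    (Mu Nu : WithTop ℝ) (hMu : 0 < Mu) (hNu : 0 < Nu)
    (hnotboth : ¬(Mu = ⊤ ∧ Nu = ⊤))
    -- Assumption 1 with M̲ = N̲ = 0, on S = {(x,z) : V(x) ≤ M̄, W(z) ≤ N̄}
    (hA1 : ∀ p : EuclideanSpace ℝ (Fin n) × EuclideanSpace ℝ (Fin m),
      (V p.1 : WithTop ℝ) ≤ Mu → (W p.2 : WithTop ℝ) ≤ Nu →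
        (γ (W p.2) ≤ V p.1 → dini V (f p) p.1 ≤ ((-(lamx p.1) : ℝ) : EReal)) ∧
        (δ (V p.1) ≤ W p.2 → dini W (g p) p.2 ≤ ((-(lamz p.2) : ℝ) : EReal)))
    -- small gain condition: γ(δ(s)) < s for all s ∈ (0, M̄] (all s ∈ (0,∞) if M̄ = ∞)
    (hA2 : ∀ s : ℝ, 0 < s → (s : WithTop ℝ) ≤ Mu → γ (δ s) < s) :
    ∃ U : EuclideanSpace ℝ (Fin n) × EuclideanSpace ℝ (Fin m) → ℝ,
      Continuous U ∧ ProperFun U ∧ PosDefFun U ∧ (∀ y, 0 ≤ U y) ∧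
      LocallyLipschitzOnSet U
        (({(0 : EuclideanSpace ℝ (Fin n) × EuclideanSpace ℝ (Fin m))} :
            Set (EuclideanSpace ℝ (Fin n) × EuclideanSpace ℝ (Fin m)))ᶜ) ∧
      -- Ω_{≤ M̂ℓ}(U) is contained in the basin of attraction of the origin,
      -- where M̂ℓ = min {δ(M̄), N̄}
      ∀ Y : ℝ → EuclideanSpace ℝ (Fin n) × EuclideanSpace ℝ (Fin m),
        (∀ t : ℝ, 0 ≤ t → HasDerivWithinAt Y (f (Y t), g (Y t)) (Set.Ici 0) t) →
        (U (Y 0) : WithTop ℝ) ≤ min (WithTop.map δ Mu) Nu →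
        (∀ t : ℝ, 0 ≤ t → (U (Y t) : WithTop ℝ) ≤ min (WithTop.map δ Mu) Nu) ∧
        Filter.Tendsto Y Filter.atTop
          (𝓝 (0 : EuclideanSpace ℝ (Fin n) × EuclideanSpace ℝ (Fin m))) := by
  obtain ⟨σ, hσc, hσ0, hσm, hσδ, hσγ, hσL⟩ := sigma_exists γ δ hγ hδ Mu hA2
  obtain ⟨M, hMeq, hM, hMN, hMM⟩ := exists_level δ σ hδ Mu Nu hMu hNu hnotboth hσm hσδ
  have hVc : Continuous V := hV.2.1.continuous
  have hWc : Continuous W := hW.2.1.continuous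
  have hσn : ∀ s, 0 ≤ s → 0 ≤ σ s := fun s hs => by
    have := hσm.monotoneOn (a := 0) (b := s) (by simp) hs hs; rwa [hσ0] at this
  have hσp : ∀ s, 0 < s → 0 < σ s := fun s hs => by
    have := hσm (a := 0) (b := s) (by simp) hs.le hs; rwa [hσ0] at this
  set U : EuclideanSpace ℝ (Fin n) × EuclideanSpace ℝ (Fin m) → ℝ :=
    fun p => max (σ (V p.1)) (W p.2) with hU
  have hUc : Continuous U := (hσc.comp (hVc.comp continuous_fst)).max (hWc.comp continuous_snd)
  have hUp : ProperFun U := by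
    intro C
    obtain ⟨B, hB⟩ := ((hδ.2.2.2.eventually_ge_atTop C).and (eventually_gt_atTop 0)).exists
    obtain ⟨R1, hR1⟩ := hV.proper B
    obtain ⟨R2, hR2⟩ := hW.proper C
    refine ⟨max R1 R2, fun y hy => ?_⟩
    rw [Prod.norm_def] at hy
    rcases le_total ‖y.1‖ ‖y.2‖ with h | h
    · rw [max_eq_right h] at hy
      exact (hR2 _ ((le_max_right _ _).trans hy)).trans (le_max_right _ _)
    · rw [max_eq_left h] at hy
      have h1 := hR1 _ ((le_max_left _ _).trans hy)
      exact (hB.1.trans ((hσδ B hB.2).le.trans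
        (hσm.monotoneOn hB.2.le (hV.1 _) h1))).trans (le_max_left _ _)
  have hUd : PosDefFun U := by
    refine ⟨by simp [hU, hV.zero, hW.zero, hσ0], fun y hy => ?_⟩
    by_cases h : y.1 = 0
    · have h2 : y.2 ≠ 0 := fun h2 => hy (Prod.ext h h2)
      exact lt_of_lt_of_le (hW.pos h2) (le_max_right _ _)
    · exact lt_of_lt_of_le (hσp _ (hV.pos h)) (le_max_left _ _)
  refine ⟨U, hUc, hUp, hUd, fun y => (hW.1 _).trans (le_max_right _ _), ?_, ?_⟩
  · intro y hy
    have hy : y ≠ 0 := hy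
    obtain ⟨KW, tW, htW, hKW⟩ := hW.2.1 y.2
    have hWl : LipschitzOnWith (KW * 1)
        (fun p : EuclideanSpace ℝ (Fin n) × EuclideanSpace ℝ (Fin m) => W p.2) (Prod.snd ⁻¹' tW) :=
      hKW.comp LipschitzWith.prod_snd.lipschitzOnWith (fun x hx => hx)
    have htW' : Prod.snd ⁻¹' tW ∈ 𝓝 y := continuous_snd.continuousAt htW
    by_cases h : y.1 = 0
    · have h2 : y.2 ≠ 0 := fun h2 => hy (Prod.ext h h2)
      have hlt : σ (V y.1) < W y.2 := by rw [h, hV.zero, hσ0]; exact hW.pos h2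
      have hev : ∀ᶠ p in 𝓝 y, σ (V p.1) < W p.2 :=
        (isOpen_lt (hσc.comp (hVc.comp continuous_fst)) (hWc.comp continuous_snd)).mem_nhds hlt
      refine ⟨KW * 1, _, mem_nhdsWithin_of_mem_nhds (inter_mem htW' hev), ?_⟩
      intro p hp q hq
      rw [show U p = W p.2 from max_eq_right (le_of_lt hp.2),
        show U q = W q.2 from max_eq_right (le_of_lt hq.2)]
      exact hWl hp.1 hq.1
    · obtain ⟨Kσ, tσ, htσ, hKσ⟩ := hσL _ (hV.pos h)
      obtain ⟨KV, tV, htV, hKV⟩ := hV.2.1 y.1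
      have hmem : tV ∩ V ⁻¹' tσ ∈ 𝓝 y.1 := inter_mem htV (hVc.continuousAt htσ)
      have h1 : LipschitzOnWith (Kσ * KV) (σ ∘ V) (tV ∩ V ⁻¹' tσ) :=
        hKσ.comp (hKV.mono inter_subset_left) (fun x hx => hx.2)
      have h2 : LipschitzOnWith (Kσ * KV * 1)
          (fun p : EuclideanSpace ℝ (Fin n) × EuclideanSpace ℝ (Fin m) => σ (V p.1))
          (Prod.fst ⁻¹' (tV ∩ V ⁻¹' tσ)) :=
        h1.comp LipschitzWith.prod_fst.lipschitzOnWith (fun x hx => hx)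
      refine ⟨max (Kσ * KV * 1) (KW * 1), _, mem_nhdsWithin_of_mem_nhds
        (inter_mem (continuous_fst.continuousAt hmem) htW'), ?_⟩
      have h3 := h2.mono (inter_subset_left (t := Prod.snd ⁻¹' tW))
      have h4 := hWl.mono (inter_subset_right (s := Prod.fst ⁻¹' (tV ∩ V ⁻¹' tσ)))
      refine LipschitzOnWith.of_dist_le_mul fun p hp q hq => ?_
      have h5 := h3.dist_le_mul p hp q hq
      have h6 := h4.dist_le_mul p hp q hq
      rw [Real.dist_eq] at h5 h6 ⊢
      refine (abs_max_sub_max_le_max _ _ _ _).trans (max_le (h5.trans ?_) (h6.trans ?_))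
      · exact mul_le_mul_of_nonneg_right (by exact_mod_cast le_max_left _ _) dist_nonneg
      · exact mul_le_mul_of_nonneg_right (by exact_mod_cast le_max_right _ _) dist_nonneg
  · intro Y hY h0
    rw [hMeq] at h0 ⊢
    have h0 : U (Y 0) ≤ M := by exact_mod_cast h0
    have hYc : ContinuousOn Y (Ici 0) := fun t ht => (hY t ht).continuousWithinAt
    have hY1 : ∀ t : ℝ, 0 ≤ t → HasDerivWithinAt (fun t => (Y t).1) (f (Y t)) (Ici 0) t :=
      fun t ht => (hY t ht).fst
    have hY2 : ∀ t : ℝ, 0 ≤ t → HasDerivWithinAt (fun t => (Y t).2) (g (Y t)) (Ici 0) t :=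
      fun t ht => (hY t ht).snd
    obtain ⟨r1, r2⟩ := abstract_conv (fun t => V (Y t).1) (fun t => W (Y t).2)
      (hVc.comp_continuousOn (continuous_fst.comp_continuousOn hYc))
      (hWc.comp_continuousOn (continuous_snd.comp_continuousOn hYc))
      (fun t => hV.1 _) (fun t => hW.1 _) γ δ σ hγ hδ Mu Nu hσc hσ0 hσm hσδ hσγ M hMM hMN hM
      (by
        intro a ha
        obtain ⟨l, hl, hl2⟩ := posdef_lower lamx hlamx.1 hlamx.2.1 hlamx.2.2 {x | a ≤ V x}
          (isClosed_le continuous_const hVc) (by simp [hV.zero, ha])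
        refine ⟨l / 2, half_pos hl, fun t ht h1 h2 h3 h4 => ?_⟩
        have h5 := hl2 _ h4
        exact slope_of_dini V hV.2.1 (fun t => (Y t).1) (f (Y t)) t _ _ ht (hY1 t ht)
          ((hA1 (Y t) h1 h2).1 h3) (by linarith))
      (by
        intro a ha
        obtain ⟨l, hl, hl2⟩ := posdef_lower lamz hlamz.1 hlamz.2.1 hlamz.2.2 {x | a ≤ W x}
          (isClosed_le continuous_const hWc) (by simp [hW.zero, ha])
        refine ⟨l / 2, half_pos hl, fun t ht h1 h2 h3 h4 => ?_⟩
        have h5 := hl2 _ h4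
        exact slope_of_dini W hW.2.1 (fun t => (Y t).2) (g (Y t)) t _ _ ht (hY2 t ht)
          ((hA1 (Y t) h1 h2).2 h3) (by linarith))
      h0
    refine ⟨fun t ht => by exact_mod_cast r1 t ht, ?_⟩
    rw [Metric.tendsto_atTop]
    intro ε hε
    obtain ⟨l, hl, hl2⟩ := posdef_lower U hUc hUd hUp {y | ε ≤ ‖y‖}
      (isClosed_le continuous_const continuous_norm) (by simp [hε])
    obtain ⟨T, hT⟩ := r2 (l / 2) (half_pos hl)
    refine ⟨T, fun t ht => ?_⟩
    rw [dist_zero_right]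
    by_contra! hcon
    have h1 := hl2 (Y t) hcon
    have h2 : U (Y t) ≤ l / 2 := hT t ht
    linarith
end
end

section
/- Corollary 2 (global attractivity). Let V be a storage function on ℝ^n and W a storage function on ℝ^m, let f ∈ C¹(ℝ^n × ℝ^m, ℝ^n), g ∈ C¹(ℝ^n × ℝ^m, ℝ^m), and suppose Assumption 1 holds with M̄ = N̄ = ∞ and constants M̲, N̲ ≥ 0 with M̲ > 0 or N̲ > 0 (so that S = {(x,z) : V(x) ≥ M̲} ∪ {(x,z) : W(z) ≥ N̲}), together with class K∞ gains γ, δ and continuous positive definite proper λ_x, λ_z, and suppose γ(δ(s)) < s for every s ∈ [M̲, ∞) \ {0}. Then there exists a continuous, proper, positive definite function U : ℝ^n × ℝ^m → [0,∞), locally Lipschitz on (ℝ^n × ℝ^m) \ {(0,0)}, such that, setting M̃g := max{γ⁻¹(M̲), N̲}, the compact set Ω_{≤M̃g}(U) is positively invariant and globally attractive for the interconnected system: every forward-complete solution Y with U(Y(0)) ≤ M̃g satisfies U(Y(t)) ≤ M̃g for all t ≥ 0, and for every forward-complete solution Y one has dist(Y(t), Ω_{≤M̃g}(U)) → 0 as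 t → ∞. -/
open Filter Topology Set

noncomputable section

theorem aux_slope {E : Type*} [NormedAddCommGroup E] [NormedSpace ℝ E]
    (V : E → ℝ) (hV : LocallyLipschitz V) (X : ℝ → E) (v : E) (t : ℝ)
    (hX : HasDerivWithinAt X v (Set.Ici t) t) (e r : ℝ)
    (hd : dini V v (X t) ≤ ((-e : ℝ) : EReal)) (hr : -e < r) :
    ∀ᶠ z in 𝓝[>] t, slope (fun s => V (X s)) t z < r := by
  obtain ⟨r', h1, h2⟩ := exists_between hr
  have hlt : dini V v (X t) < ((r' : ℝ) : EReal) := lt_of_le_of_lt hd (by exact_mod_cast h1)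
  have hev : ∀ᶠ τ in 𝓝[>] (0:ℝ), (V (X t + τ • v) - V (X t)) / τ < r' := by
    have := Filter.eventually_lt_of_limsup_lt hlt
    filter_upwards [this] with τ hτ
    exact_mod_cast hτ
  have htr : Tendsto (fun z : ℝ => z - t) (𝓝[>] t) (𝓝[>] 0) := by
    apply tendsto_nhdsWithin_of_tendsto_nhds_of_eventually_within
    · have : Tendsto (fun z : ℝ => z - t) (𝓝 t) (𝓝 (t - t)) :=
        (continuous_id.sub continuous_const).tendsto t
      rw [sub_self] at this
      exact this.mono_left nhdsWithin_le_nhds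
    · filter_upwards [self_mem_nhdsWithin] with z hz
      have : t < z := hz
      simpa using this
  have hev2 := htr.eventually hev
  obtain ⟨K, s, hs, hK⟩ := hV (X t)
  have hXc : Tendsto X (𝓝[>] t) (𝓝 (X t)) :=
    (hX.continuousWithinAt.tendsto).mono_left (nhdsWithin_mono _ Ioi_subset_Ici_self)
  have hLc : Tendsto (fun z : ℝ => X t + (z - t) • v) (𝓝[>] t) (𝓝 (X t)) := by
    have : Tendsto (fun z : ℝ => X t + (z - t) • v) (𝓝 t) (𝓝 (X t + (t - t) • v)) :=
      (by fun_prop : Continuous (fun z : ℝ => X t + (z - t) • v)).tendsto t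
    rw [sub_self, zero_smul, add_zero] at this
    exact this.mono_left nhdsWithin_le_nhds
  have hc : 0 < (r - r') / (K + 1) := by
    have : (0:ℝ) ≤ K := K.2
    apply div_pos <;> linarith
  have hlo := (hasDerivWithinAt_iff_isLittleO.1 hX).def hc
  have hlo' := hlo.filter_mono (nhdsWithin_mono t (Ioi_subset_Ici_self (a := t)))
  filter_upwards [hev2, hXc hs, hLc hs, hlo', self_mem_nhdsWithin] with z a1 a2 a3 a4 a5
  have a5' : 0 < z - t := sub_pos.2 a5
  have hl := hK.dist_le_mul _ a2 _ a3
  rw [Real.dist_eq, dist_eq_norm] at hl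
  have e1 : X z - (X t + (z - t) • v) = X z - X t - (z - t) • v := by abel
  rw [e1] at hl
  rw [Real.norm_eq_abs, abs_of_pos a5'] at a4
  have hK0 : (0:ℝ) ≤ K := K.2
  have h3 : V (X z) - V (X t + (z - t) • v) ≤ (r - r') * (z - t) := by
    calc _ ≤ _ := le_abs_self _
      _ ≤ _ := hl
      _ ≤ (K + 1) * ((r - r') / (K + 1) * (z - t)) := by
        apply mul_le_mul (by linarith) a4 (norm_nonneg _) (by linarith)
      _ = _ := by field_simp
  rw [div_lt_iff₀ a5'] at a1
  rw [slope_def_field, div_lt_iff₀ a5']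
  nlinarith

theorem aux_decay_s3 (φ : ℝ → ℝ) (T l ε : ℝ) (hε : 0 < ε) (hc : ContinuousOn φ (Set.Ici T))
    (h : ∀ t, T ≤ t → l ≤ φ t → ∀ r, -ε < r → ∀ᶠ z in 𝓝[>] t, slope φ t z < r) :
    ∃ T', T ≤ T' ∧ ∀ t, T' ≤ t → φ t ≤ l := by
  classical
  have key : ∀ T', T ≤ T' → φ T' ≤ l → ∀ t, T' ≤ t → φ t ≤ l := by
    intro T' hT' h0 t ht
    have hcl : IsClosed ({s | φ s ≤ l} ∩ Icc T' t) := by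
      have hcc : ContinuousOn φ (Icc T' t) := hc.mono (fun s hs => hT'.trans hs.1)
      have := hcc.preimage_isClosed_of_isClosed isClosed_Icc (isClosed_Iic (a := l))
      rw [inter_comm]; exact this
    have := hcl.Icc_subset_of_forall_mem_nhdsWithin h0 (fun s hs => by
      have hsT : T ≤ s := hT'.trans hs.2.1
      rcases lt_or_eq_of_le (show φ s ≤ l from hs.1) with h1 | h1
      · have hcs : Tendsto φ (𝓝[>] s) (𝓝 (φ s)) :=
          ((hc s hsT).mono (fun u hu => hsT.trans (le_of_lt hu))).tendsto
        filter_upwards [hcs.eventually (gt_mem_nhds h1)] with u hu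
        exact le_of_lt hu
      · filter_upwards [h s hsT h1.ge 0 (by linarith), self_mem_nhdsWithin] with u hu hu2
        have : 0 < u - s := sub_pos.2 hu2
        rw [slope_def_field, div_lt_iff₀ this] at hu
        show φ u ≤ l
        linarith)
    exact this ⟨ht, le_rfl⟩
  by_cases hex : ∃ T', T ≤ T' ∧ φ T' ≤ l
  · obtain ⟨T', h1, h2⟩ := hex
    exact ⟨T', h1, key T' h1 h2⟩
  · exfalso
    push Not at hex
    have hb : ∀ b, T ≤ b → φ b ≤ φ T - ε * (b - T) := by
      intro b hb
      have := image_le_of_liminf_slope_right_le_deriv_boundary (f := φ) (a := T) (b := b)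
        (B := fun s => φ T - ε * (s - T)) (B' := fun _ => -ε)
        (hc.mono (fun s hs => hs.1)) (by simp) (by fun_prop)
        (fun s _ => by
          have h1 := (((hasDerivAt_id s).sub_const T).const_mul ε).const_sub (φ T)
          simpa using h1.hasDerivWithinAt)
        (fun s hs r hr => (h s hs.1 (hex s hs.1).le r hr).frequently)
      exact this ⟨hb, le_rfl⟩
    have h1 := hex T le_rfl
    have h2 : T ≤ T + (φ T - l) / ε := by
      have : 0 < (φ T - l) / ε := div_pos (by linarith) hε
      linarith
    have h3 := hb _ h2
    have h4 := hex _ h2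
    have : ε * (T + (φ T - l) / ε - T) = φ T - l := by field_simp; ring
    linarith

theorem aux_storage_pos {E : Type*} [NormedAddCommGroup E] {V : E → ℝ} (hV : IsStorage V) :
    V 0 = 0 ∧ ∀ x, x ≠ 0 → 0 < V x := by
  obtain ⟨h0, _, a, b, ha, hb, hab⟩ := hV
  constructor
  · have := (hab 0).2
    rw [norm_zero, hb.2.2.1] at this
    exact le_antisymm this (h0 0)
  · intro x hx
    have hn := norm_pos_iff.2 hx
    have := ha.2.1 (mem_Ici.2 le_rfl) (mem_Ici.2 hn.le) hn
    rw [ha.2.2.1] at this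
    exact this.trans_le (hab x).1

theorem aux_storage_proper {E : Type*} [NormedAddCommGroup E] {V : E → ℝ} (hV : IsStorage V) :
    ProperFun V := by
  obtain ⟨h0, _, a, b, ha, hb, hab⟩ := hV
  intro C
  obtain ⟨R, hR⟩ := (ha.2.2.2.eventually_ge_atTop C).exists_forall_of_atTop
  exact ⟨R, fun y hy => (hR _ hy).trans (hab y).1⟩

theorem aux_lower {E : Type*} [NormedAddCommGroup E] [ProperSpace E] {V lam : E → ℝ}
    (hV : IsStorage V) (hl : Continuous lam ∧ PosDefFun lam ∧ ProperFun lam) (l : ℝ) (h : 0 < l) :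
    ∃ ε, 0 < ε ∧ ∀ x, l ≤ V x → ε ≤ lam x := by
  obtain ⟨R, hR⟩ := hl.2.2 1
  have hcomp : IsCompact (Metric.closedBall (0:E) R ∩ {x | l ≤ V x}) :=
    (isCompact_closedBall 0 R).inter_right (isClosed_le continuous_const hV.2.1.continuous)
  rcases (Metric.closedBall (0:E) R ∩ {x | l ≤ V x}).eq_empty_or_nonempty with he | hne
  · refine ⟨1, one_pos, fun x hx => ?_⟩
    apply hR
    by_contra hlt
    have : x ∈ Metric.closedBall (0:E) R ∩ {x | l ≤ V x} :=
      ⟨by simpa using (not_le.1 hlt).le, hx⟩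
    rw [he] at this
    exact this
  · obtain ⟨x0, hx0, hmin⟩ := hcomp.exists_isMinOn hne hl.1.continuousOn
    have hx00 : x0 ≠ 0 := by
      rintro rfl
      have h2 : l ≤ V 0 := hx0.2
      rw [(aux_storage_pos hV).1] at h2
      linarith
    refine ⟨min 1 (lam x0), lt_min one_pos (hl.2.1.2 _ hx00), fun x hx => ?_⟩
    rcases le_total R ‖x‖ with h1 | h1
    · exact (min_le_left _ _).trans (hR x h1)
    · exact (min_le_right _ _).trans (hmin (Set.mem_inter (by simpa using h1) hx))

theorem aux_main {E F : Type*} [NormedAddCommGroup E] [NormedSpace ℝ E] [ProperSpace E]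
    [NormedAddCommGroup F] [NormedSpace ℝ F] [ProperSpace F]
    (V : E → ℝ) (W : F → ℝ) (hV : IsStorage V) (hW : IsStorage W)
    (f : E × F → E) (g : E × F → F)
    (γ δ : ℝ → ℝ) (hγ : ClassKInf γ) (hδ : ClassKInf δ)
    (lamx : E → ℝ) (lamz : F → ℝ)
    (hlamx : Continuous lamx ∧ PosDefFun lamx ∧ ProperFun lamx)
    (hlamz : Continuous lamz ∧ PosDefFun lamz ∧ ProperFun lamz)
    (Ml Nl : ℝ)
    (hA1 : ∀ p : E × F,
      (Ml ≤ V p.1 ∨ Nl ≤ W p.2) →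
        (γ (W p.2) ≤ V p.1 → dini V (f p) p.1 ≤ ((-(lamx p.1) : ℝ) : EReal)) ∧
        (δ (V p.1) ≤ W p.2 → dini W (g p) p.2 ≤ ((-(lamz p.2) : ℝ) : EReal)))
    (hA2 : ∀ s : ℝ, Ml ≤ s → s ≠ 0 → γ (δ s) < s)
    (M : ℝ) (hM : 0 < M) (hMN : Nl ≤ M) (hMM : Ml ≤ γ M)
    (Y : ℝ → E × F)
    (hY : ∀ t : ℝ, 0 ≤ t → HasDerivWithinAt Y (f (Y t), g (Y t)) (Set.Ici 0) t) :
    (∀ c, M ≤ c → V (Y 0).1 ≤ γ c → W (Y 0).2 ≤ c →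
      ∀ t, 0 ≤ t → V (Y t).1 ≤ γ c ∧ W (Y t).2 ≤ c) ∧
    (∀ v, γ M < v → ∀ᶠ t in atTop, V (Y t).1 ≤ v) ∧
    (∀ w, M < w → ∀ᶠ t in atTop, W (Y t).2 ≤ w) := by
  have hγm : ∀ {a b : ℝ}, 0 ≤ a → a ≤ b → γ a ≤ γ b := fun ha hab =>
    hγ.2.1.monotoneOn ha (le_trans ha hab : (0:ℝ) ≤ _) hab
  have hδm : ∀ {a b : ℝ}, 0 ≤ a → a ≤ b → δ a ≤ δ b := fun ha hab =>
    hδ.2.1.monotoneOn ha (le_trans ha hab : (0:ℝ) ≤ _) hab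
  have hγp : ∀ {c : ℝ}, 0 < c → 0 < γ c := fun {c} hc => by
    have := hγ.2.1 (mem_Ici.2 le_rfl) (mem_Ici.2 hc.le) hc
    rwa [hγ.2.2.1] at this
  have hδ0 : ∀ {c : ℝ}, 0 ≤ c → 0 ≤ δ c := fun {c} hc => by
    have := hδm le_rfl hc
    rwa [hδ.2.2.1] at this
  have hsg : ∀ c, M ≤ c → δ (γ c) < c := by
    intro c hc
    have hc0 : 0 < c := hM.trans_le hc
    have h1 := hA2 (γ c) (hMM.trans (hγm hM.le hc)) (hγp hc0).ne'
    exact (hγ.2.1.lt_iff_lt (mem_Ici.2 (hδ0 (hγp hc0).le)) (mem_Ici.2 hc0.le)).1 h1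
  have hYc : ContinuousOn Y (Ici 0) := fun t ht => (hY t ht).continuousWithinAt
  have hVc : ContinuousOn (fun t => V (Y t).1) (Ici 0) :=
    hV.2.1.continuous.comp_continuousOn (continuous_fst.comp_continuousOn hYc)
  have hWc : ContinuousOn (fun t => W (Y t).2) (Ici 0) :=
    hW.2.1.continuous.comp_continuousOn (continuous_snd.comp_continuousOn hYc)
  have hY1 : ∀ t, 0 ≤ t → HasDerivWithinAt (fun s => (Y s).1) (f (Y t)) (Ici t) t := by
    intro t ht
    have h1 := (hY t ht).mono (Ici_subset_Ici.2 ht)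
    exact (hasFDerivAt_fst (𝕜 := ℝ) (p := Y t)).comp_hasDerivWithinAt t h1
  have hY2 : ∀ t, 0 ≤ t → HasDerivWithinAt (fun s => (Y s).2) (g (Y t)) (Ici t) t := by
    intro t ht
    have h1 := (hY t ht).mono (Ici_subset_Ici.2 ht)
    exact (hasFDerivAt_snd (𝕜 := ℝ) (p := Y t)).comp_hasDerivWithinAt t h1
  have hsV : ∀ t, 0 ≤ t → Ml ≤ V (Y t).1 → γ (W (Y t).2) ≤ V (Y t).1 →
      ∀ r, -(lamx (Y t).1) < r → ∀ᶠ z in 𝓝[>] t, slope (fun s => V (Y s).1) t z < r :=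
    fun t ht h1 h2 r hr => aux_slope V hV.2.1 (fun s => (Y s).1) _ t (hY1 t ht) _ r
      ((hA1 (Y t) (Or.inl h1)).1 h2) hr
  have hsW : ∀ t, 0 ≤ t → Nl ≤ W (Y t).2 → δ (V (Y t).1) ≤ W (Y t).2 →
      ∀ r, -(lamz (Y t).2) < r → ∀ᶠ z in 𝓝[>] t, slope (fun s => W (Y s).2) t z < r :=
    fun t ht h1 h2 r hr => aux_slope W hW.2.1 (fun s => (Y s).2) _ t (hY2 t ht) _ r
      ((hA1 (Y t) (Or.inr h1)).2 h2) hr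
  have inv : ∀ c, M ≤ c → V (Y 0).1 ≤ γ c → W (Y 0).2 ≤ c →
      ∀ t, 0 ≤ t → V (Y t).1 ≤ γ c ∧ W (Y t).2 ≤ c := by
    intro c hc hV0 hW0 t ht
    have hc0 : 0 < c := hM.trans_le hc
    have hγc : 0 < γ c := hγp hc0
    have hcl : IsClosed ({s | V (Y s).1 ≤ γ c ∧ W (Y s).2 ≤ c} ∩ Icc 0 t) := by
      have h1 := (hVc.mono (fun s hs => hs.1 : Icc 0 t ⊆ Ici 0)).preimage_isClosed_of_isClosed
        isClosed_Icc (isClosed_Iic (a := γ c))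
      have h2 := (hWc.mono (fun s hs => hs.1 : Icc 0 t ⊆ Ici 0)).preimage_isClosed_of_isClosed
        isClosed_Icc (isClosed_Iic (a := c))
      convert h1.inter h2 using 1
      ext s
      simp only [mem_inter_iff, mem_ofPred_eq, mem_preimage, mem_Iic]
      tauto
    have := hcl.Icc_subset_of_forall_mem_nhdsWithin ⟨hV0, hW0⟩ (fun s hs => by
      have hs0 : 0 ≤ s := hs.2.1
      have hsub : Ioi s ⊆ Ici 0 := fun u hu => hs0.trans (le_of_lt hu)
      have hVe : ∀ᶠ u in 𝓝[>] s, V (Y u).1 ≤ γ c := by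
        rcases lt_or_eq_of_le hs.1.1 with h1 | h1
        · have hcs := ((hVc s hs0).mono hsub).tendsto
          filter_upwards [hcs.eventually (gt_mem_nhds h1)] with u hu
          exact le_of_lt hu
        · have hne : (Y s).1 ≠ 0 := by
            intro h0
            rw [h0, (aux_storage_pos hV).1] at h1
            linarith
          have hl := hlamx.2.1.2 _ hne
          filter_upwards [hsV s hs0 (by rw [h1]; exact hMM.trans (hγm hM.le hc))
            (by rw [h1]; exact hγm (hW.1 _) hs.1.2) 0 (by linarith), self_mem_nhdsWithin]
            with u hu hu2
          have : 0 < u - s := sub_pos.2 hu2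
          rw [slope_def_field, div_lt_iff₀ this] at hu
          linarith
      have hWe : ∀ᶠ u in 𝓝[>] s, W (Y u).2 ≤ c := by
        rcases lt_or_eq_of_le hs.1.2 with h1 | h1
        · have hcs := ((hWc s hs0).mono hsub).tendsto
          filter_upwards [hcs.eventually (gt_mem_nhds h1)] with u hu
          exact le_of_lt hu
        · have hne : (Y s).2 ≠ 0 := by
            intro h0
            rw [h0, (aux_storage_pos hW).1] at h1
            linarith
          have hl := hlamz.2.1.2 _ hne
          filter_upwards [hsW s hs0 (by rw [h1]; exact hMN.trans hc)
            (by rw [h1]; exact (hδm (hV.1 _) hs.1.1).trans (hsg c hc).le) 0 (by linarith),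
            self_mem_nhdsWithin] with u hu hu2
          have : 0 < u - s := sub_pos.2 hu2
          rw [slope_def_field, div_lt_iff₀ this] at hu
          linarith
      exact hVe.and hWe)
    exact this ⟨ht, le_rfl⟩
  -- set of eventual levels
  let C : Set ℝ := {c | M ≤ c ∧ ∀ᶠ t in atTop, V (Y t).1 ≤ γ c ∧ W (Y t).2 ≤ c}
  have hCne : C.Nonempty := by
    obtain ⟨c, hc1, hc2⟩ := ((hγ.2.2.2.eventually_ge_atTop (V (Y 0).1)).and
      (eventually_ge_atTop (max M (W (Y 0).2)))).exists
    refine ⟨c, (le_max_left _ _).trans hc2, ?_⟩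
    filter_upwards [eventually_ge_atTop 0] with t ht
    exact inv c ((le_max_left _ _).trans hc2) hc1 ((le_max_right _ _).trans hc2) t ht
  have hCb : BddBelow C := ⟨M, fun c hc => hc.1⟩
  have hMC : M ≤ sInf C := le_csInf hCne (fun c hc => hc.1)
  have hinf : sInf C = M := by
    by_contra hne
    have hlt : M < sInf C := lt_of_le_of_ne hMC (Ne.symm hne)
    have hS0 : 0 < sInf C := hM.trans hlt
    have hγat : ContinuousAt γ (sInf C) := hγ.1.continuousAt (Ici_mem_nhds hS0)
    have hδat : ContinuousAt δ (γ (sInf C)) := hδ.1.continuousAt (Ici_mem_nhds (hγp hS0))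
    have hcomp : ContinuousAt (fun c => δ (γ c)) (sInf C) :=
      ContinuousAt.comp (f := γ) (g := δ) hδat hγat
    have hev := hcomp.tendsto.eventually (gt_mem_nhds (hsg _ hMC))
    obtain ⟨η, hη, hball⟩ := Metric.eventually_nhds_iff.1 hev
    obtain ⟨c, hcC, hcl⟩ := exists_lt_of_csInf_lt hCne (lt_add_of_pos_right (sInf C) hη)
    have hcge : sInf C ≤ c := csInf_le hCb hcC
    have hdc : δ (γ c) < sInf C := hball (by
      rw [Real.dist_eq, abs_of_nonneg (by linarith)]; linarith)
    obtain ⟨l, hl1, hl2⟩ : ∃ l, l = max (δ (γ c)) M ∧ l < sInf C := ⟨_, rfl, max_lt hdc hlt⟩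
    have hlM : M ≤ l := hl1 ▸ le_max_right _ _
    have hld : δ (γ c) ≤ l := hl1 ▸ le_max_left _ _
    have hl0 : 0 < l := hM.trans_le hlM
    obtain ⟨T0, hT0⟩ := hcC.2.exists_forall_of_atTop
    obtain ⟨ε, hε, hεW⟩ := aux_lower hW hlamz l hl0
    obtain ⟨T1, hT1, hT1'⟩ := aux_decay_s3 (fun t => W (Y t).2) (max T0 0) l ε hε
      (hWc.mono (Ici_subset_Ici.2 (le_max_right _ _))) (fun t ht hlt r hr => by
        refine hsW t ((le_max_right _ _).trans ht) (hMN.trans (hlM.trans hlt)) ?_ r ?_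
        · exact (hδm (hV.1 _) (hT0 t ((le_max_left _ _).trans ht)).1).trans (hld.trans hlt)
        · have := hεW _ hlt
          linarith)
    have hT10 : 0 ≤ T1 := (le_max_right _ _).trans hT1
    obtain ⟨ε', hε', hεV⟩ := aux_lower hV hlamx (γ l) (hγp hl0)
    obtain ⟨T2, hT2, hT2'⟩ := aux_decay_s3 (fun t => V (Y t).1) T1 (γ l) ε' hε'
      (hVc.mono (Ici_subset_Ici.2 hT10)) (fun t ht hlt r hr => by
        refine hsV t (hT10.trans ht) ((hMM.trans (hγm hM.le hlM)).trans hlt) ?_ r ?_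
        · exact (hγm (hW.1 _) (hT1' t ht)).trans hlt
        · have := hεV _ hlt
          linarith)
    have hlC : l ∈ C := by
      refine ⟨hlM, ?_⟩
      filter_upwards [eventually_ge_atTop T2] with t ht
      exact ⟨hT2' t ht, hT1' t (hT2.trans ht)⟩
    exact absurd (csInf_le hCb hlC) (not_le.2 hl2)
  refine ⟨inv, ?_, ?_⟩
  · intro v hv
    have hγat : ContinuousAt γ M := hγ.1.continuousAt (Ici_mem_nhds hM)
    obtain ⟨η, hη, hball⟩ := Metric.eventually_nhds_iff.1 (hγat.tendsto.eventually (gt_mem_nhds hv))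
    obtain ⟨c, hcC, hcl⟩ := exists_lt_of_csInf_lt hCne (lt_add_of_pos_right (sInf C) hη)
    have hcM := hcC.1
    have hcv : γ c < v := hball (by
      rw [Real.dist_eq, abs_of_nonneg (by linarith)]; linarith)
    filter_upwards [hcC.2] with t ht
    exact ht.1.trans hcv.le
  · intro w hw
    rw [← hinf] at hw
    obtain ⟨c, hcC, hcl⟩ := exists_lt_of_csInf_lt hCne hw
    filter_upwards [hcC.2] with t ht
    exact ht.2.trans hcl.le

/-- **Corollary 2** (global attractivity). -/
theorem corollary2_global_attractivity
    (n m : ℕ) (hn : 1 ≤ n) (hm : 1 ≤ m)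
    (V : EuclideanSpace ℝ (Fin n) → ℝ) (W : EuclideanSpace ℝ (Fin m) → ℝ)
    (hV : IsStorage V) (hW : IsStorage W)
    (f : EuclideanSpace ℝ (Fin n) × EuclideanSpace ℝ (Fin m) → EuclideanSpace ℝ (Fin n))
    (g : EuclideanSpace ℝ (Fin n) × EuclideanSpace ℝ (Fin m) → EuclideanSpace ℝ (Fin m))
    (hf : ContDiff ℝ 1 f) (hg : ContDiff ℝ 1 g)
    (γ δ γinv : ℝ → ℝ) (hγ : ClassKInf γ) (hδ : ClassKInf δ)
    (hγinv₁ : ∀ s, 0 ≤ s → γinv (γ s) = s) (hγinv₂ : ∀ s, 0 ≤ s → γ (γinv s) = s)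
    (lamx : EuclideanSpace ℝ (Fin n) → ℝ) (lamz : EuclideanSpace ℝ (Fin m) → ℝ)
    (hlamx : Continuous lamx ∧ PosDefFun lamx ∧ ProperFun lamx)
    (hlamz : Continuous lamz ∧ PosDefFun lamz ∧ ProperFun lamz)
    (Ml Nl : ℝ) (hMl : 0 ≤ Ml) (hNl : 0 ≤ Nl) (hpos : 0 < Ml ∨ 0 < Nl)
    -- Assumption 1 with M̄ = N̄ = ∞, on S = {(x,z) : V(x) ≥ M̲} ∪ {(x,z) : W(z) ≥ N̲}
    (hA1 : ∀ p : EuclideanSpace ℝ (Fin n) × EuclideanSpace ℝ (Fin m),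
      (Ml ≤ V p.1 ∨ Nl ≤ W p.2) →
        (γ (W p.2) ≤ V p.1 → dini V (f p) p.1 ≤ ((-(lamx p.1) : ℝ) : EReal)) ∧
        (δ (V p.1) ≤ W p.2 → dini W (g p) p.2 ≤ ((-(lamz p.2) : ℝ) : EReal)))
    -- small gain condition on [M̲, ∞) \ {0}
    (hA2 : ∀ s : ℝ, Ml ≤ s → s ≠ 0 → γ (δ s) < s) :
    ∃ U : EuclideanSpace ℝ (Fin n) × EuclideanSpace ℝ (Fin m) → ℝ,
      Continuous U ∧ ProperFun U ∧ PosDefFun U ∧ (∀ y, 0 ≤ U y) ∧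
      LocallyLipschitzOnSet U
        (({(0 : EuclideanSpace ℝ (Fin n) × EuclideanSpace ℝ (Fin m))} :
            Set (EuclideanSpace ℝ (Fin n) × EuclideanSpace ℝ (Fin m)))ᶜ) ∧
      -- the sublevel set Ω_{≤ M̃g}(U), with M̃g = max {γ⁻¹(M̲), N̲}, is compact ...
      IsCompact {y : EuclideanSpace ℝ (Fin n) × EuclideanSpace ℝ (Fin m) |
          U y ≤ max (γinv Ml) Nl} ∧
      -- ... positively invariant ...
      (∀ Y : ℝ → EuclideanSpace ℝ (Fin n) × EuclideanSpace ℝ (Fin m),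
        (∀ t : ℝ, 0 ≤ t → HasDerivWithinAt Y (f (Y t), g (Y t)) (Set.Ici 0) t) →
        U (Y 0) ≤ max (γinv Ml) Nl →
        ∀ t : ℝ, 0 ≤ t → U (Y t) ≤ max (γinv Ml) Nl) ∧
      -- ... and globally attractive
      (∀ Y : ℝ → EuclideanSpace ℝ (Fin n) × EuclideanSpace ℝ (Fin m),
        (∀ t : ℝ, 0 ≤ t → HasDerivWithinAt Y (f (Y t), g (Y t)) (Set.Ici 0) t) →
        Filter.Tendsto
          (fun t : ℝ => Metric.infDist (Y t)
            {y : EuclideanSpace ℝ (Fin n) × EuclideanSpace ℝ (Fin m) |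
              U y ≤ max (γinv Ml) Nl})
          Filter.atTop (𝓝 0)) := by
  have hγm : ∀ {a b : ℝ}, 0 ≤ a → a ≤ b → γ a ≤ γ b := fun ha hab =>
    hγ.2.1.monotoneOn ha (le_trans ha hab : (0:ℝ) ≤ _) hab
  have hginv0 : ∀ s, 0 ≤ s → 0 ≤ γinv s := by
    intro s hs
    obtain ⟨b, hb1, hb2⟩ := ((hγ.2.2.2.eventually_ge_atTop s).and (eventually_ge_atTop 0)).exists
    have := intermediate_value_Icc hb2 (hγ.1.mono (fun u hu => hu.1))
    obtain ⟨u, hu, rfl⟩ := this (⟨by rw [hγ.2.2.1]; exact hs, hb1⟩ : s ∈ Icc (γ 0) (γ b))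
    rw [hγinv₁ u hu.1]
    exact hu.1
  obtain ⟨M, hMdef⟩ : ∃ M, M = max (γinv Ml) Nl := ⟨_, rfl⟩
  rw [← hMdef]
  have hMN : Nl ≤ M := hMdef ▸ le_max_right _ _
  have hMg : γinv Ml ≤ M := hMdef ▸ le_max_left _ _
  have hMM : Ml ≤ γ M := by
    have := hγm (hginv0 Ml hMl) hMg
    rwa [hγinv₂ Ml hMl] at this
  have hM : 0 < M := by
    rcases hpos with h | h
    · refine lt_of_lt_of_le (lt_of_le_of_ne (hginv0 Ml hMl) ?_) hMg
      intro h0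
      have := hγinv₂ Ml hMl
      rw [← h0, hγ.2.2.1] at this
      linarith
    · exact h.trans_le hMN
  have ha : 0 < γ M := by
    have := hγ.2.1 (mem_Ici.2 le_rfl) (mem_Ici.2 hM.le) hM
    rwa [hγ.2.2.1] at this
  obtain ⟨k, hk, hkM⟩ : ∃ k, 0 < k ∧ k * γ M = M :=
    ⟨M / γ M, div_pos hM ha, by field_simp⟩
  have hVcont := hV.2.1.continuous
  have hWcont := hW.2.1.continuous
  let U : EuclideanSpace ℝ (Fin n) × EuclideanSpace ℝ (Fin m) → ℝ :=
    fun p => max (k * V p.1) (W p.2)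
  have hUc : Continuous U := by fun_prop
  have hsub : ∀ y, U y ≤ M ↔ V y.1 ≤ γ M ∧ W y.2 ≤ M := by
    intro y
    show max _ _ ≤ M ↔ _
    rw [max_le_iff]
    refine and_congr_left fun _ => ?_
    conv_lhs => rw [← hkM]
    exact mul_le_mul_iff_right₀ hk
  have hUproper : ProperFun U := by
    intro C
    obtain ⟨R1, h1⟩ := aux_storage_proper hV (C / k)
    obtain ⟨R2, h2⟩ := aux_storage_proper hW C
    refine ⟨max R1 R2, fun y hy => ?_⟩
    rw [Prod.norm_def, le_max_iff] at hy
    rcases hy with h | h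
    · have := h1 _ ((le_max_left _ _).trans h)
      rw [div_le_iff₀ hk] at this
      exact le_trans (by linarith) (le_max_left _ _)
    · exact (h2 _ ((le_max_right _ _).trans h)).trans (le_max_right _ _)
  have hcompact : ∀ c, IsCompact {y | U y ≤ c} := by
    intro c
    obtain ⟨R, hR⟩ := hUproper (c + 1)
    refine (isCompact_closedBall 0 R).of_isClosed_subset
      (isClosed_le hUc continuous_const) (fun y hy => ?_)
    by_contra hcon
    have h1 := hR y (by
      have : ¬ ‖y‖ ≤ R := by simpa using hcon
      linarith)
    have h2 : U y ≤ c := hy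
    linarith
  have hU0 : ∀ y, 0 ≤ U y := fun y => (hW.1 _).trans (le_max_right _ _)
  have main := aux_main V W hV hW f g γ δ hγ hδ lamx lamz hlamx hlamz Ml Nl hA1 hA2 M hM hMN hMM
  refine ⟨U, hUc, hUproper, ⟨?_, ?_⟩, hU0, ?_, hcompact M, ?_, ?_⟩
  · show max (k * V 0) (W 0) = 0
    rw [(aux_storage_pos hV).1, (aux_storage_pos hW).1]
    simp
  · intro y hy
    by_cases h1 : y.1 = 0
    · have h2 : y.2 ≠ 0 := fun h2 => hy (Prod.ext h1 h2)
      exact ((aux_storage_pos hW).2 _ h2).trans_le (le_max_right _ _)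
    · exact (mul_pos hk ((aux_storage_pos hV).2 _ h1)).trans_le (le_max_left _ _)
  · have hk' : LocallyLipschitz (fun v : ℝ => k * v) :=
      (lipschitzWith_smul k).locallyLipschitz
    have hL : LocallyLipschitz U :=
      (hk'.comp (hV.2.1.comp LipschitzWith.prod_fst.locallyLipschitz)).max
        (hW.2.1.comp LipschitzWith.prod_snd.locallyLipschitz)
    intro y _
    obtain ⟨K, t, ht, hK⟩ := hL y
    exact ⟨K, t, mem_nhdsWithin_of_mem_nhds ht, hK⟩
  · intro Y hY h0 t ht
    have h1 := (hsub _).1 h0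
    exact (hsub _).2 ((main Y hY).1 M le_rfl h1.1 h1.2 t ht)
  · intro Y hY
    obtain ⟨_, hVe, hWe⟩ := main Y hY
    have hUe : ∀ c, M < c → ∀ᶠ t in atTop, U (Y t) ≤ c := by
      intro c hc
      filter_upwards [hVe (c / k) (by rw [lt_div_iff₀ hk]; linarith), hWe c hc] with t h1 h2
      rw [le_div_iff₀ hk] at h1
      exact max_le (by linarith) h2
    rw [Metric.tendsto_nhds]
    intro ε hε
    obtain ⟨c, hc, hcε⟩ : ∃ c, M < c ∧ ∀ y, U y ≤ c → Metric.infDist y {y | U y ≤ M} < ε := by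
      have hcomp : IsCompact ({y | U y ≤ M + 1} ∩ {y | ε ≤ Metric.infDist y {y | U y ≤ M}}) :=
        (hcompact (M + 1)).inter_right
          (isClosed_le continuous_const (Metric.continuous_infDist_pt _))
      rcases ({y | U y ≤ M + 1} ∩
        {y | ε ≤ Metric.infDist y {y | U y ≤ M}}).eq_empty_or_nonempty with he | hne
      · refine ⟨M + 1, by linarith, fun y hy => ?_⟩
        by_contra hcon
        have : y ∈ ({y | U y ≤ M + 1} ∩ {y | ε ≤ Metric.infDist y {y | U y ≤ M}}) :=
          ⟨hy, not_lt.1 hcon⟩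
        rw [he] at this
        exact this
      · obtain ⟨y0, hy0, hmin⟩ := hcomp.exists_isMinOn hne hUc.continuousOn
        have hgt : M < U y0 := by
          by_contra hcon
          have h1 : ε ≤ Metric.infDist y0 {y | U y ≤ M} := hy0.2
          rw [Metric.infDist_zero_of_mem (show y0 ∈ {y | U y ≤ M} from not_lt.1 hcon)] at h1
          linarith
        obtain ⟨c, hc1, hc2⟩ := exists_between hgt
        refine ⟨c, hc1, fun y hy => ?_⟩
        by_contra hcon
        have h2 : U y0 ≤ M + 1 := hy0.1
        have h3 : U y0 ≤ U y := hmin (Set.mem_inter (show U y ≤ M + 1 by linarith) (not_lt.1 hcon))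
        linarith
    filter_upwards [hUe c hc] with t ht
    rw [Real.dist_eq, sub_zero, abs_of_nonneg Metric.infDist_nonneg]
    exact hcε _ ht
end
end
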